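/- arXiv:2009.04992 — 3 statements merged into one kernel-verified Lean document; each statement's English description precedes it below -/
import Mathlib

section
/- There is an absolute constant C > 0 such that for every weighted hypergraph H = (V, E, w) on n ≥ 2 vertices and every ε ∈ (0,1), there exists a (1±ε)-approximate cut sparsifier Ĥ = (V, Ê, ŵ) of H with at most C·n·(log n)/ε² hyperedges. -/
open Finset
open scoped Classical

/-- A hyperedge `e` crosses the cut `S` if it has at least one vertex in `S` and at least
one vertex outside `S`. -/
def hCrosses {V E : Type} (he : E → Finset V) (S : Finset V) (e : E) : Prop :=
  ((he e) ∩ S).Nonempty ∧ ((he e) \ S).Nonempty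

/-- The weight of the cut `S` in the weighted hypergraph `(V, E, w)`. -/
noncomputable def hCutWt {V E : Type} [Fintype E] (he : E → Finset V) (w : E → ℝ)
    (S : Finset V) : ℝ :=
  ∑ e : E, if hCrosses he S e then w e else 0

open Module (finrank)

lemma aux_pick {W E : Type} [AddCommGroup W] [Module (ZMod 2) W] [Finite W] [Fintype E]
    (K : E → Submodule (ZMod 2) W) (w : E → ℝ) (hw : ∀ e, 0 < w e)
    (A : Submodule (ZMod 2) W) :
    ∃ (B : Submodule (ZMod 2) W) (κ : ℝ), B ≤ A ∧ 0 ≤ κ ∧ (A ≠ ⊥ → B < A) ∧ (A = ⊥ → κ = 0) ∧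
      (∀ C ≤ A, ∑ e with C ≤ K e ∧ ¬ A ≤ K e, w e ≤
        κ * ((finrank (ZMod 2) A : ℝ) - finrank (ZMod 2) C)) ∧
      (∑ e with B ≤ K e ∧ ¬ A ≤ K e, w e =
        κ * ((finrank (ZMod 2) A : ℝ) - finrank (ZMod 2) B)) := by
  by_cases hA : A = ⊥
  · subst hA
    refine ⟨⊥, 0, le_rfl, le_rfl, fun h => (h rfl).elim, fun _ => rfl, ?_, ?_⟩
    · intro C hC
      simp
    · simp
  · have hfin : ({B | B < A} : Set (Submodule (ZMod 2) W)).Finite := Set.toFinite _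
    obtain ⟨B, hB, hmax⟩ := Set.exists_max_image {B | B < A}
      (fun B => (∑ e with B ≤ K e ∧ ¬ A ≤ K e, w e) /
        ((finrank (ZMod 2) A : ℝ) - finrank (ZMod 2) B)) hfin ⟨⊥, bot_lt_iff_ne_bot.mpr hA⟩
    have hd : ∀ C < A, (0 : ℝ) < (finrank (ZMod 2) A : ℝ) - finrank (ZMod 2) C := by
      intro C hC
      have := Submodule.finrank_lt_finrank_of_lt hC
      have : (finrank (ZMod 2) C : ℝ) < finrank (ZMod 2) A := by exact_mod_cast this
      linarith
    refine ⟨B, (∑ e with B ≤ K e ∧ ¬ A ≤ K e, w e) /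
        ((finrank (ZMod 2) A : ℝ) - finrank (ZMod 2) B),
        le_of_lt hB, ?_, fun _ => hB, fun h => (hA h).elim, ?_, ?_⟩
    · exact div_nonneg (sum_nonneg fun e _ => (hw e).le) (hd B hB).le
    · intro C hC
      rcases hC.lt_or_eq with h | h
      · have := hmax C h
        rw [← div_le_iff₀ (hd C h)]
        exact this
      · subst h
        rw [Finset.filter_false_of_mem]
        · simp
        · rintro e - ⟨h1, h2⟩
          exact h2 h1
    · rw [div_mul_cancel₀ _ (hd B hB).ne']

lemma aux_decomp {W E : Type} [AddCommGroup W] [Module (ZMod 2) W] [Finite W] [Fintype E]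
    (K : E → Submodule (ZMod 2) W) (w : E → ℝ) (hw : ∀ e, 0 < w e) (hK : ∀ e, K e ≠ ⊤)
    (n : ℕ) (hn : finrank (ZMod 2) W = n) :
    ∃ (L : ℕ → Submodule (ZMod 2) W) (κ : ℕ → ℝ) (i : E → ℕ) (x : E → ℝ),
      (∀ e, 0 < x e) ∧ (∀ e, w e = κ (i e) * x e) ∧ (Antitone κ) ∧ (∀ j, 0 ≤ κ j) ∧
      κ n = 0 ∧ (∀ e, i e < n) ∧ (∀ e j, L j ≤ K e ↔ i e < j) ∧ (∑ e, x e ≤ n) ∧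
      (∀ j, 0 < κ j → ∀ M : Submodule (ZMod 2) W,
        (finrank (ZMod 2) M : ℝ) - finrank (ZMod 2) (M ⊓ L (j+1) : Submodule (ZMod 2) W) ≤
          ∑ e with i e < j + 1 ∧ ¬ M ≤ K e, x e) := by
  choose B κ hBA hκ0 hlt hbot hden heq using aux_pick K w hw
  set L : ℕ → Submodule (ZMod 2) W := fun j => B^[j] ⊤ with hLdef
  have hL0 : L 0 = ⊤ := rfl
  have hLs : ∀ j, L (j+1) = B (L j) := fun j => Function.iterate_succ_apply' B j ⊤
  have hLanti : Antitone L := antitone_nat_of_succ_le fun j => by rw [hLs]; exact hBA _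
  have hdim : ∀ j, finrank (ZMod 2) (L j) ≤ n - j := by
    intro j
    induction j with
    | zero => rw [hL0, finrank_top, hn]; simp
    | succ j ih =>
      rw [hLs]
      by_cases h : L j = ⊥
      · have : B (L j) = ⊥ := le_bot_iff.mp (h ▸ hBA (L j))
        rw [this]; simp
      · have := Submodule.finrank_lt_finrank_of_lt (hlt _ h)
        omega
  have hLn : L n = ⊥ := by
    have := hdim n
    rw [Nat.sub_self] at this
    exact Submodule.finrank_eq_zero.mp (Nat.le_zero.mp this)
  have hex : ∀ e, ∃ j, L j ≤ K e := fun e => ⟨n, by rw [hLn]; exact bot_le⟩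
  have hm : ∀ e j, L j ≤ K e ↔ Nat.find (hex e) ≤ j := by
    intro e j
    constructor
    · intro h; exact Nat.find_min' _ h
    · intro h; exact (hLanti h).trans (Nat.find_spec (hex e))
  have hm1 : ∀ e, 1 ≤ Nat.find (hex e) := by
    intro e
    by_contra h
    have h0 : Nat.find (hex e) ≤ 0 := by omega
    rw [← hm, hL0, top_le_iff] at h0
    exact hK e h0
  set i : E → ℕ := fun e => Nat.find (hex e) - 1 with hi
  have hi' : ∀ e j, L j ≤ K e ↔ i e < j := by
    intro e j
    rw [hm]; have := hm1 e; simp only [hi]; omega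
  have hin : ∀ e, i e < n := fun e => (hi' e n).mp (by rw [hLn]; exact bot_le)
  set k : ℕ → ℝ := fun j => κ (L j) with hk
  have hkn : k n = 0 := hbot _ hLn
  have hieq : ∀ e j, i e = j ↔ (L (j+1) ≤ K e ∧ ¬ L j ≤ K e) := by
    intro e j; rw [hi', hi']; omega
  have hdimle : ∀ j, (finrank (ZMod 2) (L (j+1)) : ℝ) ≤ finrank (ZMod 2) (L j) := by
    intro j
    exact_mod_cast Submodule.finrank_mono (hLanti (Nat.le_succ j))
  have hstepsum : ∀ j, ∑ e with i e = j, w e =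
      k j * ((finrank (ZMod 2) (L j) : ℝ) - finrank (ZMod 2) (L (j+1))) := by
    intro j
    have := heq (L j)
    rw [← hLs] at this
    rw [← this]
    simp only [hieq]
  have hkanti : Antitone k := by
    refine antitone_nat_of_succ_le fun j => ?_
    by_cases h : L (j+1) = ⊥
    · have : k (j+1) = 0 := hbot _ h
      rw [this]; exact hκ0 _
    · have h1 := hden (L j) (L (j+2)) (hLanti (by omega))
      have h2 := hstepsum j
      have h3 := hstepsum (j+1)
      have h4 : ∑ e with L (j+2) ≤ K e ∧ ¬ L j ≤ K e, w e =
        ∑ e with i e = j, w e + ∑ e with i e = j+1, w e := by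
        rw [← Finset.sum_union]
        · congr 1
          ext e
          simp only [mem_filter, mem_univ, true_and, mem_union]
          rw [hi', hi']; omega
        · rw [Finset.disjoint_filter]
          intro e _ h1 h2; omega
      have h5 : (finrank (ZMod 2) (L (j+2)) : ℝ) < finrank (ZMod 2) (L (j+1)) := by
        have := Submodule.finrank_lt_finrank_of_lt (hlt _ h)
        rw [← hLs] at this
        exact_mod_cast this
      rw [h4, h2, h3] at h1
      change _ ≤ k j * _ at h1
      by_contra hc
      push Not at hc
      have : j + 1 + 1 = j + 2 := rfl
      rw [this] at h1
      nlinarith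
  have hkpos : ∀ e, 0 < k (i e) := by
    intro e
    have h1 := hstepsum (i e)
    have h2 : w e ≤ ∑ e' with i e' = i e, w e' :=
      Finset.single_le_sum (f := w) (fun e' _ => (hw e').le) (by simp)
    rcases (hκ0 (L (i e))).lt_or_eq with h | h
    · exact h
    · have : k (i e) = 0 := h.symm
      rw [h1, this, zero_mul] at h2
      exact absurd (hw e) (not_lt.mpr h2)
  have hstepx : ∀ j (s : Finset E), (∀ e ∈ s, i e = j) →
      k j * ∑ e ∈ s, w e / k (i e) = ∑ e ∈ s, w e := by
    intro j s hs
    rw [mul_sum]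
    refine sum_congr rfl fun e he => ?_
    have := hkpos e
    rw [hs e he] at this ⊢
    field_simp
  refine ⟨L, k, i, fun e => w e / k (i e), fun e => div_pos (hw e) (hkpos e), ?_, hkanti,
    fun j => hκ0 _, hkn, hin, hi', ?_, ?_⟩
  · intro e
    have := hkpos e
    field_simp
  · rw [← Finset.sum_fiberwise_of_maps_to (s := univ) (t := range n) (g := i)
      (fun e _ => mem_range.mpr (hin e))]
    calc _ ≤ ∑ j ∈ range n, ((finrank (ZMod 2) (L j) : ℝ) - finrank (ZMod 2) (L (j+1))) := by
          refine sum_le_sum fun j _ => ?_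
          have h1 := hstepx j (univ.filter fun e => i e = j) (by simp)
          rw [hstepsum] at h1
          rcases (hκ0 (L j)).lt_or_eq with h | h
          · exact (mul_left_cancel₀ h.ne' h1).le
          · rw [Finset.sum_eq_zero]
            · linarith [hdimle j]
            · intro e he
              simp only [mem_filter, mem_univ, true_and] at he
              have := hkpos e
              rw [he] at this
              exact absurd h this.ne
      _ ≤ n := by
          rw [Finset.sum_range_sub']
          have := hdim 0
          have h2 : (finrank (ZMod 2) (L 0) : ℝ) ≤ n := by exact_mod_cast this
          have h3 : (0:ℝ) ≤ finrank (ZMod 2) (L n) := by positivity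
          linarith
  · intro j hj M
    have step : ∀ j, 0 < k j → (finrank (ZMod 2) (M ⊓ L j : Submodule (ZMod 2) W) : ℝ) -
        finrank (ZMod 2) (M ⊓ L (j+1) : Submodule (ZMod 2) W) ≤
        ∑ e with i e = j ∧ ¬ M ≤ K e, w e / k (i e) := by
      intro j hj
      have hAB : L (j+1) ≤ L j := hLanti (Nat.le_succ j)
      set C := (M ⊓ L j) ⊔ L (j+1) with hC
      have hCA : C ≤ L j := sup_le inf_le_right hAB
      have h1 := hden (L j) C hCA
      have h2 := hstepsum j
      have h3 : ∑ e with i e = j, w e ≤ ∑ e with C ≤ K e ∧ ¬ L j ≤ K e, w e +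
          ∑ e with i e = j ∧ ¬ M ≤ K e, w e := by
        rw [← Finset.sum_union_inter]
        refine le_add_of_le_of_nonneg ?_ (sum_nonneg fun e _ => (hw e).le)
        · apply Finset.sum_le_sum_of_subset_of_nonneg
          · intro e
            simp only [mem_filter, mem_univ, true_and, mem_union]
            intro he
            by_cases hM : M ≤ K e
            · left
              exact ⟨sup_le (inf_le_left.trans hM) ((hieq e j).mp he).1, ((hieq e j).mp he).2⟩
            · exact Or.inr ⟨he, hM⟩
          · intro e _ _; exact (hw e).le
      have h4 := Submodule.finrank_sup_add_finrank_inf_eq (M ⊓ L j) (L (j+1))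
      rw [inf_assoc, inf_eq_right.mpr hAB] at h4
      have h5 : (finrank (ZMod 2) C : ℝ) + finrank (ZMod 2) (M ⊓ L (j+1) : Submodule (ZMod 2) W)
        = finrank (ZMod 2) (M ⊓ L j : Submodule (ZMod 2) W) + finrank (ZMod 2) (L (j+1)) := by
        exact_mod_cast h4
      rw [← hstepx j (univ.filter fun e => i e = j ∧ ¬ M ≤ K e) (by simp +contextual), h2] at h3
      change _ ≤ k j * _ at h1
      refine le_of_mul_le_mul_left ?_ hj
      have h6 := h3.trans (add_le_add_left h1 _)
      have : k j * (finrank (ZMod 2) C : ℝ) + k j * finrank (ZMod 2) (M ⊓ L (j+1) : Submodule (ZMod 2) W)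
        = k j * finrank (ZMod 2) (M ⊓ L j : Submodule (ZMod 2) W) + k j * finrank (ZMod 2) (L (j+1)) := by
        rw [← mul_add, h5, mul_add]
      linarith
    have key : ∀ m, m ≤ j + 1 → (finrank (ZMod 2) M : ℝ) -
        finrank (ZMod 2) (M ⊓ L m : Submodule (ZMod 2) W) ≤
          ∑ e with i e < m ∧ ¬ M ≤ K e, w e / k (i e) := by
      intro m
      induction m with
      | zero => intro _; rw [hL0, inf_top_eq]; simp
      | succ m ih =>
        intro hmj
        have h1 := ih (by omega)
        have h2 := step m (lt_of_lt_of_le hj (hkanti (by omega)))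
        have h3 : ∑ e with i e < m + 1 ∧ ¬ M ≤ K e, w e / k (i e) =
          ∑ e with i e < m ∧ ¬ M ≤ K e, w e / k (i e) +
          ∑ e with i e = m ∧ ¬ M ≤ K e, w e / k (i e) := by
          rw [← Finset.sum_union]
          · congr 1
            ext e
            simp only [mem_filter, mem_univ, true_and, mem_union]
            constructor
            · rintro ⟨h, h'⟩
              rcases Nat.lt_succ_iff_lt_or_eq.mp h with h | h
              · exact Or.inl ⟨h, h'⟩
              · exact Or.inr ⟨h, h'⟩
            · rintro (⟨h, h'⟩ | ⟨h, h'⟩)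
              · exact ⟨by omega, h'⟩
              · exact ⟨by omega, h'⟩
          · rw [Finset.disjoint_filter]
            intro e _ h1 h2; omega
        rw [h3]; linarith
    exact key (j+1) le_rfl

lemma aux_card {W : Type} [AddCommGroup W] [Module (ZMod 2) W] [Fintype W]
    (M : Submodule (ZMod 2) W) :
    ((univ.filter (fun f : W => f ∈ M)).card : ℝ) = 2 ^ finrank (ZMod 2) M := by
  have h := Module.card_eq_pow_finrank (K := ZMod 2) (V := M)
  rw [ZMod.card] at h
  have h2 : (univ.filter (fun f : W => f ∈ M)).card = Fintype.card M := by
    rw [Fintype.card_subtype]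
  rw [h2, h]; push_cast; rfl

lemma aux_count {W E : Type} [AddCommGroup W] [Module (ZMod 2) W] [Fintype W]
    (K : E → Submodule (ZMod 2) W) (x : E → ℝ) (hx : ∀ e, 0 ≤ x e) (F : Finset E)
    (L : Submodule (ZMod 2) W) (hL : ∀ e ∈ F, L ≤ K e)
    (hs : ∀ M, L ≤ M → (finrank (ZMod 2) M : ℝ) - finrank (ZMod 2) L ≤
      ∑ e ∈ F with ¬ M ≤ K e, x e) :
    ∀ (d : ℕ) (M : Submodule (ZMod 2) W), L ≤ M →
      finrank (ZMod 2) M = finrank (ZMod 2) L + d → ∀ β : ℝ, 0 ≤ β →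
      ∑ f : W with f ∈ M, Real.exp (-β * ∑ e ∈ F with f ∉ K e, x e) ≤
        2 ^ (finrank (ZMod 2) L) * (1 + Real.exp (-β)) ^ d := by
  intro d
  induction d using Nat.strong_induction_on with
  | _ d ih =>
  intro M hLM hd β hβ
  rcases Nat.eq_zero_or_pos d with h0 | hpos
  · subst h0
    have hML : L = M := Submodule.eq_of_le_of_finrank_eq hLM (by omega)
    subst hML
    rw [pow_zero, mul_one, ← aux_card, Finset.card_eq_sum_ones, Nat.cast_sum]
    refine sum_le_sum fun f hf => ?_
    simp only [mem_filter, mem_univ, true_and] at hf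
    rw [Finset.filter_false_of_mem (s := F)]
    · simp
    · intro e he h; exact h (hL e he hf)
  obtain ⟨d, rfl⟩ : ∃ d', d = d' + 1 := ⟨d - 1, by omega⟩
  set l := finrank (ZMod 2) L with hl
  set X := ∑ e ∈ F with ¬ M ≤ K e, x e with hX
  set y : W → ℝ := fun f => ∑ e ∈ F with f ∉ K e, x e with hy
  have hXd : (d : ℝ) + 1 ≤ X := by
    have := hs M hLM
    rw [hd] at this
    push_cast at this
    linarith
  -- recursion bound
  have hrec : ∀ b : ℝ, 0 ≤ b → ∑ f : W with f ∈ M, (X - y f) * Real.exp (-b * y f) ≤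
      X * (2 ^ l * (1 + Real.exp (-b)) ^ d) := by
    intro b hb
    have h1 : ∀ f ∈ univ.filter (fun f : W => f ∈ M), (X - y f) * Real.exp (-b * y f) =
        ∑ e ∈ F with ¬ M ≤ K e, x e * (if f ∈ K e then Real.exp (-b * y f) else 0) := by
      intro f hf
      simp only [mem_filter, mem_univ, true_and] at hf
      have h2 : y f = ∑ e ∈ F with ¬ M ≤ K e, if f ∈ K e then 0 else x e := by
        simp only [hy]
        rw [Finset.sum_filter, Finset.sum_filter]
        refine sum_congr rfl fun e _ => ?_
        by_cases h : f ∈ K e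
        · simp [h]
        · have : ¬ M ≤ K e := fun hM => h (hM hf)
          simp [h, this]
      have h3 : X - y f = ∑ e ∈ F with ¬ M ≤ K e, if f ∈ K e then x e else 0 := by
        rw [h2, hX, ← sum_sub_distrib]
        refine sum_congr rfl fun e _ => ?_
        split_ifs <;> simp
      rw [h3, sum_mul]
      refine sum_congr rfl fun e _ => ?_
      split_ifs <;> simp
    rw [sum_congr rfl h1, sum_comm, hX, sum_mul]
    refine sum_le_sum fun e he => ?_
    rw [← mul_sum]
    refine mul_le_mul_of_nonneg_left ?_ (hx e)
    simp only [mem_filter] at he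
    have hlt : M ⊓ K e < M := inf_lt_left.mpr he.2
    have hle : L ≤ M ⊓ K e := le_inf hLM (hL e he.1)
    have hr := Submodule.finrank_lt_finrank_of_lt hlt
    have hr2 := Submodule.finrank_mono hle
    have := ih (finrank (ZMod 2) (M ⊓ K e : Submodule (ZMod 2) W) - l) (by omega) (M ⊓ K e) hle
      (by omega) b hb
    rw [← Finset.sum_filter, Finset.filter_filter]
    simp only [Submodule.mem_inf] at this
    refine this.trans ?_
    refine mul_le_mul_of_nonneg_left ?_ (by positivity)
    refine pow_le_pow_right₀ ?_ (by omega)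
    have := Real.exp_pos (-b)
    linarith
  set φ : ℝ → ℝ := fun b => 2 ^ l * (Real.exp (X * b) * (1 + Real.exp (-b)) ^ (d+1)) -
    ∑ f : W with f ∈ M, Real.exp ((X - y f) * b) with hφ
  have hder : ∀ b, HasDerivAt φ (2 ^ l * (Real.exp (X * b) * X * (1 + Real.exp (-b)) ^ (d+1) +
      Real.exp (X * b) * (((d + 1 : ℕ) : ℝ) * (1 + Real.exp (-b)) ^ d * (-Real.exp (-b)))) -
      ∑ f : W with f ∈ M, Real.exp ((X - y f) * b) * (X - y f)) b := by
    intro b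
    have e1 : HasDerivAt (fun b => Real.exp (X * b)) (Real.exp (X * b) * X) b := by
      simpa using ((hasDerivAt_id b).const_mul X).exp
    have e2 : HasDerivAt (fun b => 1 + Real.exp (-b)) (-Real.exp (-b)) b := by
      simpa using ((hasDerivAt_id b).neg.exp).const_add 1
    have e3 := e2.pow (d+1)
    simp only [Nat.add_sub_cancel] at e3
    refine HasDerivAt.sub ((e1.mul e3).const_mul _) ?_
    refine HasDerivAt.fun_sum fun f _ => ?_
    simpa using ((hasDerivAt_id b).const_mul (X - y f)).exp
  have hmono : MonotoneOn φ (Set.Ici 0) := by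
    refine monotoneOn_of_deriv_nonneg (convex_Ici 0)
      (fun b _ => (hder b).continuousAt.continuousWithinAt)
      (fun b _ => (hder b).differentiableAt.differentiableWithinAt) ?_
    intro b hb
    rw [interior_Ici] at hb
    rw [(hder b).deriv]
    have h1 := hrec b (le_of_lt hb)
    have h2 : ∑ f : W with f ∈ M, Real.exp ((X - y f) * b) * (X - y f) =
        Real.exp (X * b) * ∑ f : W with f ∈ M, (X - y f) * Real.exp (-b * y f) := by
      rw [mul_sum]
      refine sum_congr rfl fun f _ => ?_
      rw [show (X - y f) * b = X * b + (-b * y f) by ring, Real.exp_add]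
      ring
    rw [h2]
    have h3 := mul_le_mul_of_nonneg_left h1 (Real.exp_pos (X * b)).le
    have hq := Real.exp_pos (-b)
    set q := Real.exp (-b)
    have h4 : 0 ≤ 2 ^ l * Real.exp (X * b) * (1 + q) ^ d * q * (X - (d + 1)) := by
      have : 0 ≤ X - (d+1) := by linarith
      positivity
    rw [pow_succ]
    push_cast
    nlinarith
  have h0 : φ 0 = 0 := by
    simp only [hφ, mul_zero, Real.exp_zero, neg_zero]
    rw [Finset.sum_const, nsmul_eq_mul, aux_card, hd, pow_add, show (1:ℝ) + 1 = 2 by norm_num]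
    ring
  have hfin := hmono (Set.mem_Ici.mpr le_rfl) (Set.mem_Ici.mpr hβ) hβ
  rw [h0] at hfin
  have h5 : ∑ f : W with f ∈ M, Real.exp ((X - y f) * β) =
        Real.exp (X * β) * ∑ f : W with f ∈ M, Real.exp (-β * y f) := by
    rw [mul_sum]
    refine sum_congr rfl fun f _ => ?_
    rw [show (X - y f) * β = X * β + (-β * y f) by ring, Real.exp_add]
  simp only [hφ] at hfin
  rw [h5] at hfin
  refine le_of_mul_le_mul_left ?_ (Real.exp_pos (X * β))
  linarith

/-- The probability of the subset `T` under independent sampling with rates `p`. -/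
noncomputable def auxProb {E : Type} [Fintype E] (p : E → ℝ) (T : Finset E) : ℝ :=
  (∏ e ∈ T, p e) * ∏ e ∈ univ \ T, (1 - p e)

lemma aux_expect {E : Type} [Fintype E] (p a b : E → ℝ) :
    ∑ T : Finset E, auxProb p T * ∏ e, (if e ∈ T then a e else b e) =
      ∏ e, (p e * a e + (1 - p e) * b e) := by
  rw [Finset.prod_add, Finset.powerset_univ]
  refine sum_congr rfl fun T _ => ?_
  have h : ∏ e, (if e ∈ T then a e else b e) = (∏ e ∈ T, a e) * ∏ e ∈ univ \ T, b e := by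
    rw [Finset.prod_ite]
    congr 1
    · congr 1; ext; simp
    · congr 1; ext; simp
  rw [h, auxProb, prod_mul_distrib, prod_mul_distrib]
  ring

lemma aux_total {E : Type} [Fintype E] (p : E → ℝ) : ∑ T : Finset E, auxProb p T = 1 := by
  have := aux_expect p (fun _ => 1) (fun _ => 1)
  simpa using this

lemma aux_card_expect {E : Type} [Fintype E] (p : E → ℝ) :
    ∑ T : Finset E, auxProb p T * (T.card : ℝ) = ∑ e, p e := by
  have h1 : ∀ e, ∑ T : Finset E, auxProb p T * (if e ∈ T then 1 else 0) = p e := by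
    intro e
    have := aux_expect p (fun _ => 1) (fun e' => if e' = e then 0 else 1)
    have h2 : ∀ T : Finset E, ∏ e', (if e' ∈ T then (1:ℝ) else if e' = e then 0 else 1) =
        if e ∈ T then 1 else 0 := by
      intro T
      rw [Finset.prod_eq_single e]
      · simp
      · intro b _ hb; simp [hb]
      · simp
    simp only [h2] at this
    rw [this, Finset.prod_eq_single e]
    · simp
    · intro b _ hb; simp [hb]
    · simp
  calc _ = ∑ T : Finset E, ∑ e, auxProb p T * (if e ∈ T then 1 else 0) := by
        refine sum_congr rfl fun T _ => ?_
        rw [← mul_sum]; simp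
    _ = _ := by
        rw [sum_comm]; exact sum_congr rfl fun e _ => h1 e

lemma aux_prob_nonneg {E : Type} [Fintype E] (p : E → ℝ) (h0 : ∀ e, 0 ≤ p e)
    (h1 : ∀ e, p e ≤ 1) (T : Finset E) : 0 ≤ auxProb p T :=
  mul_nonneg (prod_nonneg fun e _ => h0 e) (prod_nonneg fun e _ => by linarith [h1 e])

/-- The centred, rescaled contribution of an edge. -/
noncomputable def auxY {E : Type} (ρ : ℝ) (x : E → ℝ) (T : Finset E) (e : E) : ℝ :=
  ρ * ((if e ∈ T then x e / min 1 (ρ * x e) else 0) - x e)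

lemma aux_chernoff {E : Type} [Fintype E] (ρ : ℝ) (hρ : 0 < ρ) (x : E → ℝ) (hx : ∀ e, 0 < x e)
    (D : Finset E) (t : ℝ) (ht : |t| ≤ 1) :
    ∑ T : Finset E, auxProb (fun e => min 1 (ρ * x e)) T * Real.exp (t * ∑ e ∈ D, auxY ρ x T e) ≤
      Real.exp (t ^ 2 * ρ * ∑ e ∈ D, x e) := by
  have h1 : ∀ T : Finset E, Real.exp (t * ∑ e ∈ D, auxY ρ x T e) =
      ∏ e, (if e ∈ T then
          (if e ∈ D then Real.exp (t * (ρ * (x e / min 1 (ρ * x e) - x e))) else 1) else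
          (if e ∈ D then Real.exp (t * (ρ * (0 - x e))) else 1)) := by
    intro T
    rw [mul_sum, Real.exp_sum]
    rw [← Finset.prod_filter_mul_prod_filter_not univ (fun e => e ∈ D)]
    rw [Finset.prod_eq_one (s := univ.filter fun e => ¬ e ∈ D), mul_one]
    · rw [Finset.filter_univ_mem]
      refine prod_congr rfl fun e he => ?_
      simp only [auxY, he, if_true]
      split_ifs <;> rfl
    · intro e he
      simp only [mem_filter, mem_univ, true_and] at he
      simp [he]
  simp only [h1]
  rw [aux_expect]
  have h2 : Real.exp (t ^ 2 * ρ * ∑ e ∈ D, x e) =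
      ∏ e, (if e ∈ D then Real.exp (t ^ 2 * ρ * x e) else 1) := by
    rw [mul_sum, Real.exp_sum, Finset.prod_ite_mem, Finset.univ_inter]
  rw [h2]
  refine prod_le_prod ?_ ?_
  · intro e _
    have hp : 0 ≤ min 1 (ρ * x e) := le_min zero_le_one (mul_pos hρ (hx e)).le
    have hp1 : min 1 (ρ * x e) ≤ 1 := min_le_left _ _
    have : 0 ≤ 1 - min 1 (ρ * x e) := by linarith
    split_ifs <;> positivity
  · intro e _
    by_cases he : e ∈ D
    · simp only [he, if_true]
      rcases le_total 1 (ρ * x e) with h | h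
      · rw [min_eq_left h]
        simp only [div_one, sub_self, mul_zero, Real.exp_zero, mul_one, zero_mul, add_zero]
        refine Real.one_le_exp ?_
        have := hx e
        positivity
      · rw [min_eq_right h]
        have hxe := hx e
        have hp : 0 < ρ * x e := mul_pos hρ hxe
        have e1 : t * (ρ * (x e / (ρ * x e) - x e)) = t * (1 - ρ * x e) := by
          field_simp
        have e2 : t * (ρ * (0 - x e)) = t * (- (ρ * x e)) := by ring
        rw [e1, e2, show t ^ 2 * ρ * x e = t ^ 2 * (ρ * x e) by ring]
        set p := ρ * x e
        have ht' := abs_le.mp ht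
        have b1 : |t * (1 - p)| ≤ 1 := by
          rw [abs_mul]
          have : |1 - p| ≤ 1 := abs_le.mpr ⟨by linarith, by linarith⟩
          exact mul_le_one₀ ht (abs_nonneg _) this
        have b2 : |t * (-p)| ≤ 1 := by
          rw [abs_mul]
          have : |(-p)| ≤ 1 := abs_le.mpr ⟨by linarith, by linarith⟩
          exact mul_le_one₀ ht (abs_nonneg _) this
        have c1 := (abs_le.mp (Real.abs_exp_sub_one_sub_id_le b1)).2
        have c2 := (abs_le.mp (Real.abs_exp_sub_one_sub_id_le b2)).2
        have c3 := Real.add_one_le_exp (t ^ 2 * p)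
        have d1 := mul_le_mul_of_nonneg_left c1 hp.le
        have d2 := mul_le_mul_of_nonneg_left c2 (show 0 ≤ 1 - p by linarith)
        have d3 : 0 ≤ t ^ 2 * p * p := by positivity
        nlinarith
    · simp [he]

lemma aux_exists {E : Type} [Fintype E] (p : E → ℝ) (h0 : ∀ e, 0 ≤ p e) (h1 : ∀ e, p e ≤ 1)
    (Φ : Finset E → ℝ) (h : ∑ T : Finset E, auxProb p T * Φ T ≤ 1) : ∃ T, Φ T ≤ 1 := by
  by_contra hc
  push Not at hc
  have h2 : ∑ T : Finset E, auxProb p T * (Φ T - 1) ≤ 0 := by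
    simp only [mul_sub, mul_one, sum_sub_distrib, aux_total]
    linarith
  have hnn : ∀ T ∈ (univ : Finset (Finset E)), 0 ≤ auxProb p T * (Φ T - 1) := fun T _ =>
    mul_nonneg (aux_prob_nonneg p h0 h1 T) (by linarith [hc T])
  have h3 := (Finset.sum_eq_zero_iff_of_nonneg hnn).mp (le_antisymm h2 (sum_nonneg hnn))
  have h4 : ∑ T : Finset E, auxProb p T = 0 := by
    refine sum_eq_zero fun T hT => ?_
    rcases mul_eq_zero.mp (h3 T hT) with h | h
    · exact h
    · linarith [hc T]
  rw [aux_total] at h4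
  exact one_ne_zero h4

lemma aux_numeric (n : ℕ) (hn : 2 ≤ n) :
    (n : ℝ) * (2 * ((1 + Real.exp (-Real.log (16 * (n : ℝ) ^ 2))) ^ n - 1)) ≤ 1 / 2 := by
  have hn' : (2 : ℝ) ≤ n := by exact_mod_cast hn
  have hpos : (0 : ℝ) < 16 * (n : ℝ) ^ 2 := by positivity
  rw [Real.exp_neg, Real.exp_log hpos]
  set q : ℝ := (16 * (n : ℝ) ^ 2)⁻¹ with hq
  have hq0 : 0 < q := by positivity
  have h1 : (1 + q) ^ n ≤ Real.exp (n * q) := by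
    rw [Real.exp_nat_mul]
    refine pow_le_pow_left₀ (by positivity) ?_ n
    linarith [Real.add_one_le_exp q]
  have h2 : (n : ℝ) * (n * q) = 1 / 16 := by
    rw [hq]; field_simp
  have h3 : 0 ≤ n * q := by positivity
  have h4 : n * q ≤ 1 := by nlinarith
  have h5 := Real.abs_exp_sub_one_le (x := n * q) (by rwa [abs_of_nonneg h3])
  rw [abs_of_nonneg h3] at h5
  have h6 := (abs_le.mp h5).2
  have h7 : (1 + q) ^ n - 1 ≤ 2 * (n * q) := by linarith
  nlinarith

lemma aux_telescope {E : Type} (κ : ℕ → ℝ) (n : ℕ) (hκn : κ n = 0) (i : E → ℕ)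
    (hi : ∀ e, i e < n) (s : Finset E) (a : E → ℝ) :
    ∑ e ∈ s, κ (i e) * a e =
      ∑ j ∈ range n, (κ j - κ (j + 1)) * ∑ e ∈ s with i e < j + 1, a e := by
  have h1 : ∀ e, κ (i e) = ∑ j ∈ range n, if i e < j + 1 then κ j - κ (j + 1) else 0 := by
    intro e
    have key : ∀ m, i e ≤ m → ∑ j ∈ range m, (if i e < j + 1 then κ j - κ (j + 1) else 0) =
        κ (i e) - κ m := by
      intro m hm
      induction m, hm using Nat.le_induction with
      | base =>
        rw [sub_self]
        refine sum_eq_zero fun j hj => ?_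
        rw [mem_range] at hj
        rw [if_neg (by omega)]
      | succ m hm ih =>
        rw [sum_range_succ, ih, if_pos (by omega)]
        ring
    rw [key n (hi e).le, hκn, sub_zero]
  calc _ = ∑ e ∈ s, ∑ j ∈ range n, (if i e < j + 1 then (κ j - κ (j + 1)) * a e else 0) := by
        refine sum_congr rfl fun e _ => ?_
        conv_lhs => rw [h1 e]
        rw [sum_mul]
        refine sum_congr rfl fun j _ => ?_
        split_ifs <;> simp
    _ = _ := by
        rw [sum_comm]
        refine sum_congr rfl fun j _ => ?_
        rw [mul_sum, ← sum_filter]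

theorem aux_code {W E : Type} [AddCommGroup W] [Module (ZMod 2) W] [Fintype W] [Fintype E]
    (K : E → Submodule (ZMod 2) W) (w : E → ℝ) (hw : ∀ e, 0 < w e) (hK : ∀ e, K e ≠ ⊤)
    (n : ℕ) (hn : finrank (ZMod 2) W = n) (hn2 : 2 ≤ n) (ε : ℝ) (hε : 0 < ε) (hε1 : ε < 1) :
    ∃ (T : Finset E) (what : E → ℝ), (∀ e, 0 ≤ what e) ∧
      (T.card : ℝ) ≤ 48 * n * Real.log n / ε ^ 2 ∧
      ∀ f : W, |(∑ e ∈ T with f ∉ K e, what e) - ∑ e with f ∉ K e, w e| ≤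
        ε * ∑ e with f ∉ K e, w e := by
  obtain ⟨L, κ, i, x, hx, hwx, hanti, hκ0, hκn, hin, hLK, hsum, hstr⟩ := aux_decomp K w hw hK n hn
  have hnR : (2 : ℝ) ≤ n := by exact_mod_cast hn2
  set β := Real.log (16 * (n : ℝ) ^ 2) with hβ
  have hβ0 : 0 < β := Real.log_pos (by nlinarith)
  set ρ := 4 * β / ε ^ 2 with hρdef
  have hρ : 0 < ρ := by positivity
  set t := ε / 2 with htdef
  have ht : |t| ≤ 1 := by rw [abs_of_pos (by positivity)]; linarith
  have ht' : |-t| ≤ 1 := by rwa [abs_neg]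
  set p : E → ℝ := fun e => min 1 (ρ * x e) with hp
  have hp0 : ∀ e, 0 < p e := fun e => lt_min one_pos (mul_pos hρ (hx e))
  have hp1 : ∀ e, p e ≤ 1 := fun e => min_le_left _ _
  set D : ℕ → W → Finset E := fun j f => univ.filter fun e => i e < j + 1 ∧ f ∉ K e with hD
  set y : ℕ → W → ℝ := fun j f => ∑ e ∈ D j f, x e with hy
  set G : ℕ → W → Finset E → ℝ := fun j f T =>
    Real.exp (t * ∑ e ∈ D j f, auxY ρ x T e) * Real.exp (- (t * ε * ρ * y j f)) +
    Real.exp (-t * ∑ e ∈ D j f, auxY ρ x T e) * Real.exp (- (t * ε * ρ * y j f)) with hG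
  set J := (range n).filter fun j => 0 < κ j with hJ
  set l : ℕ → ℕ := fun j => finrank (ZMod 2) (L (j+1)) with hl
  set Φ : Finset E → ℝ := fun T => (T.card : ℝ) * (2 * ρ * n)⁻¹ +
    ∑ j ∈ J, ((2:ℝ) ^ l j)⁻¹ * ∑ f with f ∉ L (j+1), G j f T with hΦ
  have hGE : ∀ j f, ∑ T : Finset E, auxProb p T * G j f T ≤ 2 * Real.exp (-β * y j f) := by
    intro j f
    have e1 := aux_chernoff ρ hρ x hx (D j f) t ht
    have e2 := aux_chernoff ρ hρ x hx (D j f) (-t) ht'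
    have e3 : ∑ T : Finset E, auxProb p T * G j f T =
      (∑ T : Finset E, auxProb p T * Real.exp (t * ∑ e ∈ D j f, auxY ρ x T e)) *
        Real.exp (- (t * ε * ρ * y j f)) +
      (∑ T : Finset E, auxProb p T * Real.exp (-t * ∑ e ∈ D j f, auxY ρ x T e)) *
        Real.exp (- (t * ε * ρ * y j f)) := by
      rw [sum_mul, sum_mul, ← sum_add_distrib]
      refine sum_congr rfl fun T _ => ?_
      simp only [hG]; ring
    have e4 : Real.exp (t ^ 2 * ρ * y j f) * Real.exp (- (t * ε * ρ * y j f)) =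
        Real.exp (-β * y j f) := by
      rw [← Real.exp_add]
      congr 1
      rw [htdef, hρdef]
      field_simp
      ring
    rw [neg_sq] at e2
    have hpos := Real.exp_pos (- (t * ε * ρ * y j f))
    have e5 := mul_le_mul_of_nonneg_right e1 hpos.le
    have e6 := mul_le_mul_of_nonneg_right e2 hpos.le
    rw [e3]
    change _ ≤ Real.exp (t ^ 2 * ρ * y j f) * _ at e5
    change _ ≤ Real.exp (t ^ 2 * ρ * y j f) * _ at e6
    rw [e4] at e5 e6
    linarith
  have hDL : ∀ j f, f ∈ L (j+1) → D j f = ∅ := by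
    intro j f hf
    refine Finset.filter_false_of_mem ?_
    rintro e - ⟨h1, h2⟩
    exact h2 ((hLK e (j+1)).mpr h1 hf)
  have hcount : ∀ j ∈ J, ((2:ℝ) ^ l j)⁻¹ * ∑ f with f ∉ L (j+1), Real.exp (-β * y j f) ≤
      (1 + Real.exp (-β)) ^ n - 1 := by
    intro j hj
    simp only [hJ, mem_filter] at hj
    have hle : l j ≤ n := hn ▸ Submodule.finrank_le _
    have h1 := aux_count K x (fun e => (hx e).le) (univ.filter fun e => i e < j + 1) (L (j+1))
      (fun e he => (hLK e _).mpr (by simpa using he))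
      (fun M hM => by
        have := hstr j hj.2 M
        rw [inf_eq_right.mpr hM] at this
        rw [Finset.filter_filter]
        exact this) (n - l j) ⊤ le_top (by rw [finrank_top, hn]; simp only [hl] at hle ⊢; omega)
      β hβ0.le
    simp only [Finset.filter_filter] at h1
    have h2 : ∑ f : W with f ∈ (⊤ : Submodule (ZMod 2) W), Real.exp (-β * y j f) =
      ∑ f : W with f ∈ L (j+1), Real.exp (-β * y j f) +
      ∑ f : W with f ∉ L (j+1), Real.exp (-β * y j f) := by
      rw [Finset.sum_filter_add_sum_filter_not]
      simp
    have h3 : ∑ f : W with f ∈ L (j+1), Real.exp (-β * y j f) = 2 ^ l j := by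
      rw [← aux_card, Finset.card_eq_sum_ones, Nat.cast_sum]
      refine sum_congr rfl fun f hf => ?_
      simp only [mem_filter, mem_univ, true_and] at hf
      simp only [hy, hDL j f hf]
      simp
    change ∑ f : W with f ∈ (⊤ : Submodule (ZMod 2) W), Real.exp (-β * y j f) ≤
      2 ^ l j * _ at h1
    rw [h2, h3] at h1
    have h4 : (1 + Real.exp (-β)) ^ (n - l j) ≤ (1 + Real.exp (-β)) ^ n :=
      pow_le_pow_right₀ (by linarith [Real.exp_pos (-β)]) (Nat.sub_le _ _)
    have h5 : (0:ℝ) < 2 ^ l j := by positivity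
    rw [inv_mul_le_iff₀ h5]
    nlinarith
  have hΦE : ∑ T : Finset E, auxProb p T * Φ T ≤ 1 := by
    have e1 : ∑ T : Finset E, auxProb p T * Φ T =
        (∑ T : Finset E, auxProb p T * (T.card : ℝ)) * (2 * ρ * n)⁻¹ +
        ∑ j ∈ J, ((2:ℝ) ^ l j)⁻¹ * ∑ f with f ∉ L (j+1), ∑ T : Finset E, auxProb p T * G j f T := by
      simp only [hΦ, mul_add, sum_add_distrib]
      congr 1
      · rw [sum_mul]
        refine sum_congr rfl fun T _ => by ring
      · simp only [mul_sum]
        rw [sum_comm]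
        refine sum_congr rfl fun j _ => ?_
        rw [sum_comm]
        refine sum_congr rfl fun f _ => ?_
        refine sum_congr rfl fun T _ => by ring
    rw [e1, aux_card_expect]
    have e2 : (∑ e, p e) * (2 * ρ * n)⁻¹ ≤ 1 / 2 := by
      have : ∑ e, p e ≤ ρ * n := by
        calc ∑ e, p e ≤ ∑ e, ρ * x e := sum_le_sum fun e _ => min_le_right _ _
          _ = ρ * ∑ e, x e := by rw [mul_sum]
          _ ≤ ρ * n := by gcongr
      rw [← div_eq_mul_inv, div_le_iff₀ (by positivity)]
      linarith
    have e3 : ∑ j ∈ J, ((2:ℝ) ^ l j)⁻¹ * ∑ f with f ∉ L (j+1),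
        ∑ T : Finset E, auxProb p T * G j f T ≤ 1 / 2 := by
      calc _ ≤ ∑ j ∈ J, 2 * ((1 + Real.exp (-β)) ^ n - 1) := by
            refine sum_le_sum fun j hj => ?_
            have h1 := hcount j hj
            have h2 : ∑ f with f ∉ L (j+1), ∑ T : Finset E, auxProb p T * G j f T ≤
              2 * ∑ f with f ∉ L (j+1), Real.exp (-β * y j f) := by
              rw [mul_sum]
              exact sum_le_sum fun f _ => hGE j f
            have h3 : (0:ℝ) ≤ (2 ^ l j)⁻¹ := by positivity
            have h4 := mul_le_mul_of_nonneg_left h2 h3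
            linarith
        _ = J.card * (2 * ((1 + Real.exp (-β)) ^ n - 1)) := by
            rw [sum_const, nsmul_eq_mul]
        _ ≤ n * (2 * ((1 + Real.exp (-β)) ^ n - 1)) := by
            refine mul_le_mul_of_nonneg_right ?_ ?_
            · have : J.card ≤ n := (card_filter_le _ _).trans (card_range n).le
              exact_mod_cast this
            · have : 1 ≤ (1 + Real.exp (-β)) ^ n :=
                one_le_pow₀ (by linarith [Real.exp_pos (-β)])
              linarith
        _ ≤ 1 / 2 := aux_numeric n hn2
    linarith
  obtain ⟨T, hT⟩ := aux_exists p (fun e => (hp0 e).le) hp1 Φ hΦE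
  have hGpos : ∀ j f, 0 < G j f T := fun j f => by simp only [hG]; positivity
  have hterm : ∀ j, 0 ≤ ((2:ℝ) ^ l j)⁻¹ * ∑ f with f ∉ L (j+1), G j f T := fun j =>
    mul_nonneg (by positivity) (sum_nonneg fun f _ => (hGpos j f).le)
  have hcardnn : 0 ≤ (T.card : ℝ) * (2 * ρ * n)⁻¹ := by positivity
  have hgood : ∀ j ∈ J, ∀ f, |∑ e ∈ D j f, auxY ρ x T e| ≤ ε * ρ * y j f := by
    intro j hj f
    by_cases hf : f ∈ L (j+1)
    · simp [hy, hDL j f hf]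
    by_contra hc
    push Not at hc
    have hG1 : 1 < G j f T := by
      have ht0 : 0 < t := by positivity
      simp only [hG]
      rw [← Real.exp_add, ← Real.exp_add]
      rcases lt_abs.mp hc with h | h
      · have h1 : 0 < t * ∑ e ∈ D j f, auxY ρ x T e + -(t * ε * ρ * y j f) := by nlinarith
        have := Real.one_lt_exp_iff.mpr h1
        linarith [Real.exp_pos (-t * ∑ e ∈ D j f, auxY ρ x T e + -(t * ε * ρ * y j f))]
      · have h1 : 0 < -t * ∑ e ∈ D j f, auxY ρ x T e + -(t * ε * ρ * y j f) := by nlinarith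
        have := Real.one_lt_exp_iff.mpr h1
        linarith [Real.exp_pos (t * ∑ e ∈ D j f, auxY ρ x T e + -(t * ε * ρ * y j f))]
    have hDeq : ∀ g ∈ L (j+1), D j (g + f) = D j f := by
      intro g hg
      simp only [hD]
      refine Finset.filter_congr fun e _ => ?_
      refine and_congr_right fun h => ?_
      have : g ∈ K e := (hLK e (j+1)).mpr h hg
      rw [Submodule.add_mem_iff_right _ this]
    have h1 : ∑ g ∈ (univ.filter fun g => g ∈ L (j+1)).map (Equiv.addRight f).toEmbedding,
        G j g T ≤ ∑ g with g ∉ L (j+1), G j g T := by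
      refine sum_le_sum_of_subset_of_nonneg ?_ fun g _ _ => (hGpos j g).le
      intro g hg
      simp only [mem_map, mem_filter, mem_univ, true_and] at hg ⊢
      obtain ⟨a, ha, rfl⟩ := hg
      intro hcon
      exact hf ((Submodule.add_mem_iff_right _ ha).mp hcon)
    rw [sum_map] at h1
    have h2 : ∑ g ∈ (univ.filter fun g => g ∈ L (j+1)), G j ((Equiv.addRight f).toEmbedding g) T =
        2 ^ l j * G j f T := by
      rw [← aux_card, ← nsmul_eq_mul, ← sum_const]
      refine sum_congr rfl fun g hg => ?_
      simp only [mem_filter, mem_univ, true_and] at hg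
      simp only [Equiv.coe_toEmbedding, Equiv.coe_addRight, hG, hy, hDeq g hg]
    rw [h2] at h1
    have h3 : ((2:ℝ) ^ l j)⁻¹ * ∑ f with f ∉ L (j+1), G j f T ≤ 1 := by
      have := Finset.single_le_sum (f := fun j => ((2:ℝ) ^ l j)⁻¹ * ∑ f with f ∉ L (j+1), G j f T)
        (fun j _ => hterm j) hj
      simp only [hΦ] at hT
      linarith
    have h5 : (0:ℝ) < 2 ^ l j := by positivity
    rw [inv_mul_le_iff₀ h5] at h3
    nlinarith
  refine ⟨T, fun e => κ (i e) * (x e / p e), fun e =>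
    mul_nonneg (hκ0 _) (div_nonneg (hx e).le (hp0 e).le), ?_, ?_⟩
  · have h1 : (T.card : ℝ) * (2 * ρ * n)⁻¹ ≤ 1 := by
      have := Finset.sum_nonneg (s := J) (fun j _ => hterm j)
      simp only [hΦ] at hT
      linarith
    rw [← div_eq_mul_inv, div_le_iff₀ (by positivity), one_mul] at h1
    refine h1.trans ?_
    have h2 : β ≤ 6 * Real.log n := by
      rw [hβ, show (6:ℝ) * Real.log n = Real.log ((n:ℝ) ^ 6) by rw [Real.log_pow]; norm_num]
      refine Real.log_le_log (by positivity) ?_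
      have : (2:ℝ) ^ 4 ≤ (n:ℝ) ^ 4 := pow_le_pow_left₀ (by norm_num) hnR 4
      nlinarith [sq_nonneg (n:ℝ)]
    rw [hρdef, show 2 * (4 * β / ε ^ 2) * (n:ℝ) = 8 * n * β / ε ^ 2 by ring]
    have h3 : 8 * n * β ≤ 48 * n * Real.log n := by nlinarith
    exact div_le_div_of_nonneg_right h3 (by positivity)
  · intro f
    have e1 : (∑ e ∈ T with f ∉ K e, κ (i e) * (x e / p e)) - ∑ e with f ∉ K e, w e =
        ∑ e with f ∉ K e, κ (i e) * (auxY ρ x T e / ρ) := by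
      have : ∑ e ∈ T with f ∉ K e, κ (i e) * (x e / p e) =
          ∑ e with f ∉ K e, if e ∈ T then κ (i e) * (x e / p e) else 0 := by
        rw [← sum_filter, Finset.filter_filter]
        congr 1
        ext e; simp [and_comm]
      rw [this, ← sum_sub_distrib]
      refine sum_congr rfl fun e _ => ?_
      rw [hwx e, auxY]
      simp only [hp]
      split_ifs <;> field_simp
      ring
    have hDe : ∀ j, ((univ.filter fun e => f ∉ K e).filter fun e => i e < j + 1) = D j f := by
      intro j
      ext e; simp [hD, and_comm]
    have e2 : ∑ e with f ∉ K e, w e = ∑ j ∈ range n, (κ j - κ (j+1)) * y j f := by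
      rw [sum_congr rfl fun e _ => hwx e, aux_telescope κ n hκn i hin]
      simp only [hDe, hy]
    rw [e1, aux_telescope κ n hκn i hin, e2, mul_sum]
    refine (Finset.abs_sum_le_sum_abs _ _).trans (sum_le_sum fun j hj => ?_)
    rw [hDe, ← sum_div]
    have hdiff : 0 ≤ κ j - κ (j+1) := sub_nonneg.mpr (hanti (Nat.le_succ j))
    rw [abs_mul, abs_of_nonneg hdiff]
    rcases (hκ0 j).lt_or_eq with h | h
    · have := hgood j (by simp only [hJ, mem_filter]; exact ⟨hj, h⟩) f
      rw [abs_div, abs_of_pos hρ]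
      have h2 : |∑ e ∈ D j f, auxY ρ x T e| / ρ ≤ ε * y j f := by
        rw [div_le_iff₀ hρ]; linarith
      calc _ ≤ (κ j - κ (j+1)) * (ε * y j f) := mul_le_mul_of_nonneg_left h2 hdiff
        _ = _ := by ring
    · have h3 : κ j - κ (j+1) = 0 := le_antisymm (by linarith [hκ0 (j+1)]) hdiff
      rw [h3]; simp

/-- The functions `V → ZMod 2` that are constant on the vertex set `s`. -/
def auxK {V : Type} (s : Finset V) : Submodule (ZMod 2) (V → ZMod 2) where
  carrier := {f | ∀ u ∈ s, ∀ v ∈ s, f u = f v}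
  add_mem' := by
    intro f g hf hg u hu v hv
    rw [Pi.add_apply, Pi.add_apply, hf u hu v hv, hg u hu v hv]
  zero_mem' := by
    intro u _ v _; rfl
  smul_mem' := by
    intro c f hf u hu v hv
    rw [Pi.smul_apply, Pi.smul_apply, hf u hu v hv]

lemma aux_crosses {V E : Type} (he : E → Finset V) (S : Finset V) (e : E) :
    hCrosses he S e ↔ (fun v => if v ∈ S then (1 : ZMod 2) else 0) ∉ auxK (he e) := by
  have hmem : (fun v => if v ∈ S then (1 : ZMod 2) else 0) ∈ auxK (he e) ↔
      ∀ u ∈ he e, ∀ v ∈ he e, (if u ∈ S then (1 : ZMod 2) else 0) = if v ∈ S then 1 else 0 :=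
    Iff.rfl
  rw [hmem]
  constructor
  · rintro ⟨⟨u, hu⟩, ⟨v, hv⟩⟩ h
    rw [mem_inter] at hu
    rw [mem_sdiff] at hv
    have := h u hu.1 v hv.1
    simp [hu.2, hv.2] at this
  · intro h
    push Not at h
    obtain ⟨u, hu, v, hv, huv⟩ := h
    by_cases h1 : u ∈ S <;> by_cases h2 : v ∈ S
    · simp [h1, h2] at huv
    · exact ⟨⟨u, mem_inter.mpr ⟨hu, h1⟩⟩, ⟨v, mem_sdiff.mpr ⟨hv, h2⟩⟩⟩
    · exact ⟨⟨v, mem_inter.mpr ⟨hv, h2⟩⟩, ⟨u, mem_sdiff.mpr ⟨hu, h1⟩⟩⟩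
    · simp [h1, h2] at huv

/-- There is an absolute constant `C > 0` such that every weighted hypergraph
on `n ≥ 2` vertices has, for every `ε ∈ (0,1)`, a `(1 ± ε)`-approximate cut sparsifier with at
most `C·n·log n / ε²` hyperedges. -/
theorem stmt0 :
    ∃ C : ℝ, 0 < C ∧
      ∀ (V E : Type) [Fintype V] [Fintype E],
        ∀ (he : E → Finset V) (w : E → ℝ),
          (∀ e, 0 ≤ w e) →
          2 ≤ Fintype.card V →
          ∀ ε : ℝ, 0 < ε → ε < 1 →
            ∃ (Ehat : Finset E) (what : E → ℝ),
              (∀ e, 0 ≤ what e) ∧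
              (Ehat.card : ℝ) ≤
                C * (Fintype.card V : ℝ) * Real.log (Fintype.card V) / ε ^ 2 ∧
              ∀ S : Finset V, S.Nonempty → S ≠ Finset.univ →
                |(∑ e ∈ Ehat, if hCrosses he S e then what e else 0) - hCutWt he w S|
                  ≤ ε * hCutWt he w S := by
  refine ⟨48, by norm_num, ?_⟩
  intro V E _ _ he w hw hV ε hε hε1
  let E' := {e : E // 0 < w e ∧ auxK (he e) ≠ ⊤}
  obtain ⟨T, wh, hwh, hcard, hT⟩ := aux_code (W := V → ZMod 2) (E := E')
    (fun e => auxK (he e.1)) (fun e => w e.1) (fun e => e.2.1) (fun e => e.2.2)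
    (Fintype.card V) (by simp) hV ε hε hε1
  obtain ⟨what, hnn, hwhat⟩ : ∃ what : E → ℝ, (∀ e, 0 ≤ what e) ∧
      ∀ e : E', what e.1 = wh e := by
    refine ⟨fun e => if h : 0 < w e ∧ auxK (he e) ≠ ⊤ then wh ⟨e, h⟩ else 0, ?_, ?_⟩
    · intro e
      beta_reduce
      by_cases h : 0 < w e ∧ auxK (he e) ≠ ⊤
      · rw [dif_pos h]; exact hwh _
      · rw [dif_neg h]
    · intro e
      exact dif_pos e.2
  refine ⟨T.map (Function.Embedding.subtype _), what, hnn, ?_, ?_⟩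
  · rw [card_map]; exact hcard
  · intro S _ _
    have h1 := hT (fun v => if v ∈ S then (1 : ZMod 2) else 0)
    have h2 : hCutWt he w S = ∑ e : E' with
        (fun v => if v ∈ S then (1 : ZMod 2) else 0) ∉ auxK (he e.1), w e.1 := by
      rw [hCutWt, ← sum_filter]
      symm
      refine Finset.sum_bij_ne_zero (fun e _ _ => e.1) ?_ ?_ ?_ ?_
      · intro e h _
        simp only [mem_filter, mem_univ, true_and] at h ⊢
        exact (aux_crosses he S e.1).mpr h
      · intro a _ _ b _ _ h
        exact Subtype.ext h
      · intro e h hne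
        simp only [mem_filter, mem_univ, true_and] at h
        rw [aux_crosses] at h
        refine ⟨⟨e, lt_of_le_of_ne (hw e) (Ne.symm hne), ?_⟩, ?_, hne, rfl⟩
        · intro htop
          rw [htop] at h
          exact h trivial
        · simp only [mem_filter, mem_univ, true_and]
          exact h
      · intro e _ _; rfl
    rw [h2, sum_map]
    have h3 : ∑ e ∈ T, (if hCrosses he S e.1 then what e.1 else 0) =
        ∑ e ∈ T with (fun v => if v ∈ S then (1 : ZMod 2) else 0) ∉ auxK (he e.1), wh e := by
      rw [sum_filter]
      refine sum_congr rfl fun e _ => ?_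
      simp only [aux_crosses, hwhat]
    rw [← h3] at h1
    exact h1
end

section
/- For every unweighted finite multi-hypergraph H = (V, E) in which every hyperedge has at least 2 vertices, and for every integer γ ≥ 2, there exists a γ-balanced weight assignment w^F : F → ℝ_{≥0}. -/
open Finset
open scoped Classical

/-- An edge `f` crosses the cut `S` if exactly one of its endpoints lies in `S`. -/
def crossesCut {V F : Type} (ep : F → V × V) (S : Finset V) (f : F) : Prop :=
  ((ep f).1 ∈ S ∧ (ep f).2 ∉ S) ∨ ((ep f).1 ∉ S ∧ (ep f).2 ∈ S)

/-- Total weight of edges of the induced subgraph `G[X]` crossing the cut `S`. -/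
noncomputable def cutWt {V F : Type} [Fintype F] (ep : F → V × V) (w : F → ℝ)
    (X S : Finset V) : ℝ :=
  ∑ f : F, if (ep f).1 ∈ X ∧ (ep f).2 ∈ X ∧ crossesCut ep S f then w f else 0

/-- The min-cut of the induced subgraph `G[X]`: the least total weight of edges of `G[X]`
crossing a cut `(S, X \ S)` with `∅ ⊊ S ⊊ X`. -/
noncomputable def minCutIn {V F : Type} [Fintype F] (ep : F → V × V) (w : F → ℝ)
    (X : Finset V) : ℝ :=
  sInf {c : ℝ | ∃ S : Finset V, S ⊆ X ∧ S.Nonempty ∧ S ≠ X ∧ c = cutWt ep w X S}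

/-- The strength of an edge `f`: the maximum of the min-cut of `G[X]` over all vertex
sets `X` containing both endpoints of `f`. -/
noncomputable def strength {V F : Type} [Fintype V] [Fintype F] (ep : F → V × V)
    (w : F → ℝ) (f : F) : ℝ :=
  sSup {c : ℝ | ∃ X : Finset V, (ep f).1 ∈ X ∧ (ep f).2 ∈ X ∧ c = minCutIn ep w X}


/-- The (multiset) union over the hyperedges `e` of the edge set `F_e` of the clique on the
vertex set of `e`: an element records the hyperedge `e` and an unordered pair of distinct
vertices of `e` (normalized so that the first vertex is smaller). -/
abbrev CliqueEdges {V E : Type} [LinearOrder V] (he : E → Finset V) : Type :=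
  {p : E × V × V // p.2.1 ∈ he p.1 ∧ p.2.2 ∈ he p.1 ∧ p.2.1 < p.2.2}

/-- The endpoints of a clique edge. -/
def cep {V E : Type} [LinearOrder V] (he : E → Finset V) : CliqueEdges he → V × V :=
  fun f => f.1.2

/-- `κ_e`: the minimum strength of an edge of the clique `F_e` in the auxiliary graph
`G = (V, F, w)`. -/
noncomputable def kappa {V E : Type} [Fintype V] [LinearOrder V] [Fintype E]
    (he : E → Finset V) (w : CliqueEdges he → ℝ) (e : E) : ℝ :=
  sInf {c : ℝ | ∃ f : CliqueEdges he, f.1.1 = e ∧ c = strength (cep he) w f}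

/-- `κ_e^max`: the maximum strength of a positive-weight edge of the clique `F_e` in the
auxiliary graph `G = (V, F, w)`. -/
noncomputable def kappaMax {V E : Type} [Fintype V] [LinearOrder V] [Fintype E]
    (he : E → Finset V) (w : CliqueEdges he → ℝ) (e : E) : ℝ :=
  sSup {c : ℝ | ∃ f : CliqueEdges he, f.1.1 = e ∧ 0 < w f ∧ c = strength (cep he) w f}

/-- A weight assignment `w : F → ℝ≥0` is `γ`-balanced if for each hyperedge `e` the weights of
the clique `F_e` sum to `1` and `κ_e^max ≤ γ·κ_e`. -/
def BalancedAssignment {V E : Type} [Fintype V] [LinearOrder V] [Fintype E]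
    (he : E → Finset V) (w : CliqueEdges he → ℝ) (γ : ℝ) : Prop :=
  ∀ e : E, (∑ f : CliqueEdges he, if f.1.1 = e then w f else 0) = 1 ∧
    kappaMax he w e ≤ γ * kappa he w e

set_option linter.unusedSectionVars false

namespace Bal

/-- total `x`-weight inside `S` -/
noncomputable def xin {V F : Type} [Fintype F] (ep : F → V × V) (x : F → ℝ) (S : Finset V) : ℝ :=
  ∑ f : F, if (ep f).1 ∈ S ∧ (ep f).2 ∈ S then x f else 0

/-- fractional forests -/
def Feas {V F : Type} [Fintype F] (ep : F → V × V) (x : F → ℝ) : Prop :=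
  (∀ f, 0 ≤ x f) ∧ ∀ S : Finset V, S.Nonempty → xin ep x S ≤ (S.card : ℝ) - 1

/-- load of a hyperedge -/
noncomputable def load {F E : Type} [Fintype F] (own : F → E) (x : F → ℝ) (e : E) : ℝ :=
  ∑ f : F, if own f = e then x f else 0

/-- tight sets -/
def Tight {V F : Type} [Fintype F] (ep : F → V × V) (x : F → ℝ) (S : Finset V) : Prop :=
  S.Nonempty ∧ xin ep x S = (S.card : ℝ) - 1

/-- the edge lies in `S` -/
def Ins {V F : Type} (ep : F → V × V) (S : Finset V) (f : F) : Prop :=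
  (ep f).1 ∈ S ∧ (ep f).2 ∈ S

section
variable {V F E : Type} [Fintype V] [Fintype F] [Fintype E]

lemma supermod (ep : F → V × V) (x : F → ℝ) (hx : ∀ f, 0 ≤ x f) (S T : Finset V) :
    xin ep x S + xin ep x T ≤ xin ep x (S ∪ T) + xin ep x (S ∩ T) := by
  unfold xin
  rw [← Finset.sum_add_distrib, ← Finset.sum_add_distrib]
  refine Finset.sum_le_sum fun f _ => ?_
  have := hx f
  simp only [Finset.mem_union, Finset.mem_inter]
  by_cases h1 : (ep f).1 ∈ S <;> by_cases h2 : (ep f).2 ∈ S <;>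
  by_cases h3 : (ep f).1 ∈ T <;> by_cases h4 : (ep f).2 ∈ T <;> simp [h1, h2, h3, h4, this]

lemma supermod_strict (ep : F → V × V) (x : F → ℝ) (hx : ∀ f, 0 ≤ x f) (S T : Finset V)
    (g : F) (hg : 0 < x g) (hu : Ins ep (S ∪ T) g) (hS : ¬ Ins ep S g) (hT : ¬ Ins ep T g) :
    xin ep x S + xin ep x T < xin ep x (S ∪ T) + xin ep x (S ∩ T) := by
  unfold xin
  rw [← Finset.sum_add_distrib, ← Finset.sum_add_distrib]
  refine Finset.sum_lt_sum (fun f _ => ?_) ⟨g, Finset.mem_univ _, ?_⟩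
  · have := hx f
    simp only [Finset.mem_union, Finset.mem_inter]
    by_cases h1 : (ep f).1 ∈ S <;> by_cases h2 : (ep f).2 ∈ S <;>
    by_cases h3 : (ep f).1 ∈ T <;> by_cases h4 : (ep f).2 ∈ T <;> simp [h1, h2, h3, h4, this]
  · unfold Ins at hu hS hT
    rw [if_neg hS, if_neg hT, if_pos hu, if_neg]
    · linarith
    · intro h
      simp only [Finset.mem_inter] at h
      exact hS ⟨h.1.1, h.2.1⟩

lemma tight_union_inter (ep : F → V × V) (x : F → ℝ) (hx : Feas ep x) (S T : Finset V)
    (hS : Tight ep x S) (hT : Tight ep x T) (hST : (S ∩ T).Nonempty) :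
    Tight ep x (S ∪ T) ∧ Tight ep x (S ∩ T) ∧
      ∀ g, 0 < x g → Ins ep (S ∪ T) g → Ins ep S g ∨ Ins ep T g := by
  have hne : (S ∪ T).Nonempty := hS.1.mono Finset.subset_union_left
  have h1 := supermod ep x hx.1 S T
  have h2 := hx.2 _ hST
  have h3 := hx.2 _ hne
  have h4 : ((S ∪ T).card : ℝ) + ((S ∩ T).card : ℝ) = S.card + T.card := by
    exact_mod_cast Finset.card_union_add_card_inter S T
  have h5 := hS.2
  have h6 := hT.2
  refine ⟨⟨hne, by linarith⟩, ⟨hST, by linarith⟩, fun g hg hu => ?_⟩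
  by_contra hcon
  push Not at hcon
  have := supermod_strict ep x hx.1 S T g hg hu hcon.1 hcon.2
  linarith

lemma exists_opt (ep : F → V × V) (hne : ∀ f, (ep f).1 ≠ (ep f).2) (own : F → E) :
    ∃ x, Feas ep x ∧ ∀ x', Feas ep x' →
      ∑ e, (load own x e - Fintype.card V) ^ 2 ≤ ∑ e, (load own x' e - Fintype.card V) ^ 2 := by
  have hc : IsCompact {x : F → ℝ | Feas ep x} := by
    refine IsCompact.of_isClosed_subset
      (isCompact_univ_pi (s := fun _ : F => Set.Icc (0:ℝ) (Fintype.card V))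
        (fun _ => isCompact_Icc)) ?_ ?_
    · have : {x : F → ℝ | Feas ep x} = (⋂ f, {x : F → ℝ | 0 ≤ x f}) ∩
          ⋂ S : Finset V, ⋂ _ : S.Nonempty, {x : F → ℝ | xin ep x S ≤ (S.card : ℝ) - 1} := by
        ext x; simp [Feas]
      rw [this]
      refine IsClosed.inter (isClosed_iInter fun f => isClosed_le continuous_const
        (continuous_apply f)) (isClosed_iInter fun S => isClosed_iInter fun _ =>
        isClosed_le ?_ continuous_const)
      unfold xin
      refine continuous_finsetSum _ fun f _ => ?_
      split_ifs
      · exact continuous_apply f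
      · exact continuous_const
    · intro x hx f _
      refine ⟨hx.1 f, ?_⟩
      have h1 := hx.2 Finset.univ ⟨(ep f).1, Finset.mem_univ _⟩
      have h2 : x f ≤ xin ep x Finset.univ := by
        simp only [xin, Finset.mem_univ, and_self, if_true]
        exact Finset.single_le_sum (fun i _ => hx.1 i) (Finset.mem_univ f)
      rw [Finset.card_univ] at h1
      linarith
  have hn : {x : F → ℝ | Feas ep x}.Nonempty := by
    refine ⟨fun _ => 0, fun _ => le_rfl, fun S hS => ?_⟩
    have : (1:ℝ) ≤ S.card := by exact_mod_cast hS.card_pos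
    simp [xin, this]
  have hcont : Continuous fun x : F → ℝ => ∑ e, (load own x e - Fintype.card V) ^ 2 := by
    unfold load
    refine continuous_finsetSum _ fun e _ => Continuous.pow (Continuous.sub ?_ continuous_const) 2
    refine continuous_finsetSum _ fun f _ => ?_
    split_ifs
    · exact continuous_apply f
    · exact continuous_const
  obtain ⟨x, hx, hm⟩ := hc.exists_isMinOn hn hcont.continuousOn
  exact ⟨x, hx, fun x' hx' => hm hx'⟩

lemma xin_add (ep : F → V × V) (x d : F → ℝ) (δ : ℝ) (S : Finset V) :
    xin ep (fun f => x f + δ * d f) S = xin ep x S + δ * xin ep d S := by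
  unfold xin
  rw [Finset.mul_sum, ← Finset.sum_add_distrib]
  refine Finset.sum_congr rfl fun f _ => ?_
  split_ifs <;> ring

lemma load_add (own : F → E) (x d : F → ℝ) (δ : ℝ) (e : E) :
    load own (fun f => x f + δ * d f) e = load own x e + δ * load own d e := by
  unfold load
  rw [Finset.mul_sum, ← Finset.sum_add_distrib]
  refine Finset.sum_congr rfl fun f _ => ?_
  split_ifs <;> ring

/-- first order optimality -/
lemma first_order (ep : F → V × V) (own : F → E) (x : F → ℝ) (hx : Feas ep x)
    (hopt : ∀ x', Feas ep x' →
      ∑ e, (load own x e - Fintype.card V) ^ 2 ≤ ∑ e, (load own x' e - Fintype.card V) ^ 2)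
    (d : F → ℝ) (hd0 : ∀ f, x f = 0 → 0 ≤ d f)
    (hdT : ∀ S, Tight ep x S → xin ep d S ≤ 0) :
    0 ≤ ∑ e, (load own x e - Fintype.card V) * load own d e := by
  have key : ∀ (a b : ℝ), 0 ≤ a → (a = 0 → 0 ≤ b) →
      ∀ᶠ δ in nhdsWithin (0:ℝ) (Set.Ioi 0), 0 ≤ a + δ * b := by
    intro a b ha hab
    rcases ha.eq_or_lt with h | h
    · filter_upwards [self_mem_nhdsWithin] with δ hδ
      have := mul_nonneg (le_of_lt hδ) (hab h.symm)
      linarith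
    · have : Filter.Tendsto (fun δ : ℝ => a + δ * b) (nhdsWithin 0 (Set.Ioi 0)) (nhds (a + 0 * b)) :=
        (Continuous.tendsto (by fun_prop) 0).mono_left nhdsWithin_le_nhds
      filter_upwards [this.eventually (lt_mem_nhds (show 0 < a + 0 * b by simpa using h))] with δ hδ
      exact hδ.le
  have hfe : ∀ᶠ δ in nhdsWithin (0:ℝ) (Set.Ioi 0), Feas ep (fun f => x f + δ * d f) := by
    have h1 : ∀ᶠ δ in nhdsWithin (0:ℝ) (Set.Ioi 0), ∀ f, 0 ≤ x f + δ * d f :=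
      Filter.eventually_all.2 fun f => key _ _ (hx.1 f) (hd0 f)
    have h2 : ∀ᶠ δ in nhdsWithin (0:ℝ) (Set.Ioi 0), ∀ S : Finset V, S.Nonempty →
        0 ≤ ((S.card : ℝ) - 1 - xin ep x S) + δ * (- xin ep d S) := by
      refine Filter.eventually_all.2 fun S => ?_
      by_cases hS : S.Nonempty
      · have := key ((S.card : ℝ) - 1 - xin ep x S) (- xin ep d S)
          (by linarith [hx.2 S hS]) (fun h => by
            have := hdT S ⟨hS, by linarith⟩
            linarith)
        filter_upwards [this] with δ hδ _ using hδ
      · exact Filter.Eventually.of_forall fun _ h => absurd h hS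
    filter_upwards [h1, h2] with δ a b
    refine ⟨a, fun S hS => ?_⟩
    have := b S hS
    rw [xin_add]
    linarith
  have hineq : ∀ᶠ δ in nhdsWithin (0:ℝ) (Set.Ioi 0),
      0 ≤ 2 * ∑ e, (load own x e - Fintype.card V) * load own d e
        + δ * ∑ e, (load own d e) ^ 2 := by
    filter_upwards [hfe, self_mem_nhdsWithin] with δ h1 h2
    have h3 := hopt _ h1
    simp only [load_add] at h3
    have h4 : ∑ e, (load own x e + δ * load own d e - Fintype.card V) ^ 2 =
        ∑ e, (load own x e - Fintype.card V) ^ 2 +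
        δ * (2 * ∑ e, (load own x e - Fintype.card V) * load own d e
        + δ * ∑ e, (load own d e) ^ 2) := by
      simp only [Finset.mul_sum, ← Finset.sum_add_distrib]
      exact Finset.sum_congr rfl fun e _ => by ring
    rw [h4] at h3
    have h2' : 0 < δ := h2
    exact nonneg_of_mul_nonneg_right (by linarith) h2'
  have hlim : Filter.Tendsto (fun δ : ℝ =>
      2 * ∑ e, (load own x e - Fintype.card V) * load own d e
        + δ * ∑ e, (load own d e) ^ 2) (nhdsWithin 0 (Set.Ioi 0))
      (nhds (2 * ∑ e, (load own x e - Fintype.card V) * load own d e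
        + 0 * ∑ e, (load own d e) ^ 2)) :=
    (Continuous.tendsto (by fun_prop) 0).mono_left nhdsWithin_le_nhds
  have := ge_of_tendsto hlim hineq
  linarith

lemma xin_single (ep : F → V × V) (f : F) (c : ℝ) (S : Finset V) :
    xin ep (Pi.single f c) S = if Ins ep S f then c else 0 := by
  unfold xin Ins
  rw [Finset.sum_eq_single f]
  · simp
  · intro b _ hb; simp [hb]
  · simp

lemma load_single (own : F → E) (f : F) (c : ℝ) (e : E) :
    load own (Pi.single f c) e = if own f = e then c else 0 := by
  unfold load
  rw [Finset.sum_eq_single f]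
  · simp
  · intro b _ hb; simp [hb]
  · simp

lemma xin_addd (ep : F → V × V) (x d : F → ℝ) (S : Finset V) :
    xin ep (x + d) S = xin ep x S + xin ep d S := by
  have := xin_add ep x d 1 S
  simp only [one_mul] at this
  exact this

lemma load_addd (own : F → E) (x d : F → ℝ) (e : E) :
    load own (x + d) e = load own x e + load own d e := by
  have := load_add own x d 1 e
  simp only [one_mul] at this
  exact this

lemma load_lt (ep : F → V × V) (own : F → E) (x : F → ℝ) (hx : Feas ep x) (f : F) (e : E) :
    load own x e < Fintype.card V := by
  have h1 := hx.2 Finset.univ ⟨(ep f).1, Finset.mem_univ _⟩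
  rw [Finset.card_univ] at h1
  have h2 : load own x e ≤ xin ep x Finset.univ := by
    unfold load xin
    refine Finset.sum_le_sum fun g _ => ?_
    have := hx.1 g
    split_ifs <;> simp_all
  linarith

lemma le_load (own : F → E) (x : F → ℝ) (hx : ∀ f, 0 ≤ x f) (f : F) :
    x f ≤ load own x (own f) := by
  unfold load
  have := Finset.single_le_sum (f := fun g => if own g = own f then x g else 0)
    (fun g _ => by split_ifs; exacts [hx g, le_rfl]) (Finset.mem_univ f)
  simpa using this

/-- every edge is contained in a tight set whose positive edges have smaller load -/
lemma exists_tight (ep : F → V × V) (own : F → E) (x : F → ℝ) (hx : Feas ep x)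
    (hopt : ∀ x', Feas ep x' →
      ∑ e, (load own x e - Fintype.card V) ^ 2 ≤ ∑ e, (load own x' e - Fintype.card V) ^ 2)
    (f : F) : ∃ D, Tight ep x D ∧ Ins ep D f ∧
      ∀ g, 0 < x g → Ins ep D g → load own x (own g) ≤ load own x (own f) := by
  have hex : ∃ D, Tight ep x D ∧ Ins ep D f := by
    by_contra hcon
    push Not at hcon
    have := first_order ep own x hx hopt (Pi.single f 1)
      (fun g _ => by
        by_cases h : g = f
        · subst h; simp
        · simp [h])
      (fun S hS => by rw [xin_single, if_neg (hcon S hS)])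
    simp only [load_single, mul_ite, mul_one, mul_zero, Finset.sum_ite_eq, Finset.mem_univ,
      if_true] at this
    have h2 := load_lt ep own x hx f (own f)
    linarith
  obtain ⟨D, hD, hmin⟩ := Finset.exists_min_image
    (Finset.univ.filter fun D : Finset V => Tight ep x D ∧ Ins ep D f) Finset.card
    (by obtain ⟨D, hD⟩ := hex; exact ⟨D, by simpa using hD⟩)
  simp only [Finset.mem_filter, Finset.mem_univ, true_and] at hD hmin
  have hsub : ∀ T, Tight ep x T → Ins ep T f → D ⊆ T := by
    intro T hT hTf
    have hI : Ins ep (D ∩ T) f := by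
      simp only [Ins, Finset.mem_inter] at *
      tauto
    have h1 := (tight_union_inter ep x hx D T hD.1 hT ⟨_, hI.1⟩).2.1
    have h2 := hmin (D ∩ T) ⟨h1, hI⟩
    have h3 := Finset.eq_of_subset_of_card_le Finset.inter_subset_left h2
    rw [← h3]; exact Finset.inter_subset_right
  refine ⟨D, hD.1, hD.2, fun g hg hgD => ?_⟩
  have := first_order ep own x hx hopt (Pi.single f 1 + Pi.single g (-1))
      (fun h h0 => by
        have : h ≠ g := by rintro rfl; linarith
        by_cases h : h = f
        · subst h; simp [this]
        · simp [h, this])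
      (fun S hS => by
        rw [xin_addd, xin_single, xin_single]
        by_cases hf : Ins ep S f
        · have := hsub S hS hf
          rw [if_pos hf, if_pos ⟨this hgD.1, this hgD.2⟩]; norm_num
        · rw [if_neg hf]; split_ifs <;> norm_num)
  simp only [load_addd, load_single, mul_add, mul_ite, mul_one, mul_neg, mul_zero,
    Finset.sum_add_distrib, Finset.sum_ite_eq, Finset.mem_univ, if_true] at this
  linarith

lemma load_pos (ep : F → V × V) (hne : ∀ f, (ep f).1 ≠ (ep f).2) (own : F → E) (x : F → ℝ)
    (hx : Feas ep x)
    (hopt : ∀ x', Feas ep x' →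
      ∑ e, (load own x e - Fintype.card V) ^ 2 ≤ ∑ e, (load own x' e - Fintype.card V) ^ 2)
    (f : F) : 0 < load own x (own f) := by
  obtain ⟨D, hD, hf, hle⟩ := exists_tight ep own x hx hopt f
  by_contra hcon
  have h0 : xin ep x D = 0 := by
    unfold xin
    refine Finset.sum_eq_zero fun g _ => ?_
    split_ifs with hg
    · by_contra hne0
      have hpos : 0 < x g := lt_of_le_of_ne (hx.1 g) (Ne.symm hne0)
      have := hle g hpos hg
      have := le_load own x hx.1 g
      linarith
    · rfl
  have h1 : 1 < D.card := Finset.one_lt_card.2 ⟨_, hf.1, _, hf.2, hne f⟩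
  have h2 : (1:ℝ) < D.card := by exact_mod_cast h1
  have := hD.2
  linarith

lemma cutWt_nonneg (ep : F → V × V) (w : F → ℝ) (hw : ∀ f, 0 ≤ w f) (X S : Finset V) :
    0 ≤ cutWt ep w X S := by
  unfold cutWt
  refine Finset.sum_nonneg fun f _ => ?_
  split_ifs
  exacts [hw f, le_rfl]

lemma le_strength (ep : F → V × V) (w : F → ℝ) (f : F) (hne : (ep f).1 ≠ (ep f).2)
    (X : Finset V) (hX : Ins ep X f)
    (c : ℝ) (hc : ∀ S, S ⊆ X → S.Nonempty → S ≠ X → c ≤ cutWt ep w X S) :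
    c ≤ strength ep w f := by
  have h1 : c ≤ minCutIn ep w X := by
    unfold minCutIn
    refine le_csInf ⟨_, {(ep f).1}, by simpa using hX.1, by simp, ?_, rfl⟩ ?_
    · intro h
      have := hX.2
      rw [← h] at this
      simp at this
      exact hne this.symm
    · rintro _ ⟨S, h1, h2, h3, rfl⟩
      exact hc S h1 h2 h3
  refine h1.trans (le_csSup ?_ ⟨X, hX.1, hX.2, rfl⟩)
  refine Set.Finite.bddAbove (Set.Finite.subset (Set.finite_range (minCutIn ep w)) ?_)
  rintro _ ⟨Y, _, _, rfl⟩
  exact ⟨Y, rfl⟩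

lemma strength_le (ep : F → V × V) (w : F → ℝ) (hw : ∀ f, 0 ≤ w f) (f : F) (c : ℝ) (hc0 : 0 ≤ c)
    (hc : ∀ X, Ins ep X f → ∃ S, S ⊆ X ∧ S.Nonempty ∧ S ≠ X ∧ cutWt ep w X S ≤ c) :
    strength ep w f ≤ c := by
  refine Real.sSup_le ?_ hc0
  rintro _ ⟨X, h1, h2, rfl⟩
  obtain ⟨S, a, b, d, h⟩ := hc X ⟨h1, h2⟩
  refine le_trans (csInf_le ⟨0, ?_⟩ ⟨S, a, b, d, rfl⟩) h
  rintro _ ⟨T, _, _, _, rfl⟩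
  exact cutWt_nonneg ep w hw X T

/-- cuts of tight sets have `x`-value at least one -/
lemma tight_cut (ep : F → V × V) (x : F → ℝ) (hx : Feas ep x) (D : Finset V)
    (hD : Tight ep x D) (S : Finset V) (h1 : S ⊆ D) (h2 : S.Nonempty) (h3 : S ≠ D) :
    1 ≤ cutWt ep x D S := by
  have hne : (D \ S).Nonempty := by
    rw [Finset.sdiff_nonempty]
    exact fun h => h3 (Finset.Subset.antisymm h1 h)
  have e : xin ep x D = xin ep x S + xin ep x (D \ S) + cutWt ep x D S := by
    unfold xin cutWt crossesCut
    rw [← Finset.sum_add_distrib, ← Finset.sum_add_distrib]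
    refine Finset.sum_congr rfl fun f _ => ?_
    have a := @h1 (ep f).1
    have b := @h1 (ep f).2
    simp only [Finset.mem_sdiff]
    by_cases p : (ep f).1 ∈ S <;> by_cases q : (ep f).2 ∈ S <;>
    by_cases r : (ep f).1 ∈ D <;> by_cases s : (ep f).2 ∈ D <;> simp_all
  have i1 := hx.2 S h2
  have i2 := hx.2 _ hne
  have i3 : (S.card : ℝ) + (D \ S).card = D.card := by
    have := Finset.card_sdiff_add_card_eq_card h1
    have h : (((D \ S).card + S.card : ℕ) : ℝ) = D.card := by rw [this]
    push_cast at h; linarith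
  have := hD.2
  linarith

/-- the small-cut lemma -/
lemma exists_small_cut (ep : F → V × V) (hne : ∀ f, (ep f).1 ≠ (ep f).2) (own : F → E) (x : F → ℝ) (hx : Feas ep x)
    (hD : ∀ f, ∃ D, Tight ep x D ∧ Ins ep D f ∧
      ∀ g, 0 < x g → Ins ep D g → load own x (own g) ≤ load own x (own f))
    (w : F → ℝ) (hw : ∀ f, w f = x f / load own x (own f))
    (f : F) (hf : 0 < x f) (X : Finset V) (hX : Ins ep X f) :
    ∃ S, S ⊆ X ∧ S.Nonempty ∧ S ≠ X ∧ cutWt ep w X S ≤ 2 / load own x (own f) := by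
  set t := load own x (own f) with ht
  have htpos : 0 < t := lt_of_lt_of_le hf (le_load own x hx.1 f)
  let Good : Finset V → Prop := fun S => Tight ep x S ∧
    ∀ g, 0 < x g → Ins ep S g → load own x (own g) < t
  have hexM : ∀ v, ∃ M, Good M ∧ v ∈ M ∧ ∀ T, Good T → (T ∩ M).Nonempty → T ⊆ M := by
    intro v
    have hsing : Good {v} := by
      refine ⟨⟨by simp, ?_⟩, ?_⟩
      · simp only [Finset.card_singleton, Nat.cast_one, sub_self]
        refine Finset.sum_eq_zero fun g _ => if_neg ?_
        rintro ⟨a, b⟩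
        rw [Finset.mem_singleton] at a b
        exact hne g (a.trans b.symm)
      · rintro g - ⟨a, b⟩
        rw [Finset.mem_singleton] at a b
        exact absurd (a.trans b.symm) (hne g)
    obtain ⟨M, hM, hmax⟩ := Finset.exists_max_image
      (Finset.univ.filter fun M : Finset V => Good M ∧ v ∈ M) Finset.card
      ⟨{v}, by simp [hsing]⟩
    simp only [Finset.mem_filter, Finset.mem_univ, true_and] at hM hmax
    refine ⟨M, hM.1, hM.2, fun T hT hTM => ?_⟩
    obtain ⟨a, -, c⟩ := tight_union_inter ep x hx T M hT.1 hM.1.1 hTM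
    have hU : Good (T ∪ M) := ⟨a, fun g hg hi =>
      (c g hg hi).elim (hT.2 g hg) (hM.1.2 g hg)⟩
    have h2 := hmax _ ⟨hU, Finset.mem_union_right _ hM.2⟩
    have h3 := Finset.eq_of_subset_of_card_le Finset.subset_union_right h2
    rw [h3]; exact Finset.subset_union_left
  choose M hMg hMv hMmax using hexM
  have hMeq : ∀ u v, u ∈ M v → M u = M v := fun u v h =>
    Finset.Subset.antisymm (hMmax v _ (hMg u) ⟨u, by simp [h, hMv]⟩)
      (hMmax u _ (hMg v) ⟨u, by simp [h, hMv]⟩)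
  -- crossing edges have large load
  have hcross : ∀ g, M (ep g).1 ≠ M (ep g).2 → t ≤ load own x (own g) := by
    intro g hg
    by_contra hlt
    push Not at hlt
    obtain ⟨D, hD1, hD2, hD3⟩ := hD g
    have hGD : Good D := ⟨hD1, fun h a b => (hD3 h a b).trans_lt hlt⟩
    have := hMmax (ep g).2 D hGD ⟨(ep g).2, by simp [hD2.2, hMv]⟩
    exact hg (hMeq _ _ (this hD2.1))
  have hfM : M (ep f).1 ≠ M (ep f).2 := by
    intro h
    have := (hMg (ep f).1).2 f hf ⟨hMv _, by rw [h]; exact hMv _⟩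
    exact lt_irrefl _ this
  let R := X.image M
  let X' := R.biUnion id
  have hRd : ∀ C ∈ R, ∀ v, v ∈ C ↔ M v = C := by
    intro C hC v
    obtain ⟨u, hu, rfl⟩ := Finset.mem_image.1 hC
    exact ⟨fun h => hMeq _ _ h, fun h => h ▸ hMv v⟩
  have hcard : (X'.card : ℝ) = ∑ C ∈ R, (C.card : ℝ) := by
    have : X'.card = ∑ C ∈ R, C.card := by
      refine Finset.card_biUnion ?_
      intro C hC C' hC' hne
      refine Finset.disjoint_left.2 fun v h1 h2 => hne ?_
      rw [← (hRd C hC v).1 h1, ← (hRd C' hC' v).1 h2]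
    rw [this]; push_cast; rfl
  have hX'X : X ⊆ X' := fun v hv =>
    Finset.mem_biUnion.2 ⟨M v, Finset.mem_image_of_mem _ hv, hMv v⟩
  have hxX' := hx.2 X' ⟨_, hX'X hX.1⟩
  have hmain : ∑ C ∈ R, cutWt ep w X (X ∩ C) ≤
      (2 / t) * (xin ep x X' - ∑ C ∈ R, xin ep x C) := by
    have hper : ∀ g : F, (∑ C ∈ R, if (ep g).1 ∈ X ∧ (ep g).2 ∈ X ∧ crossesCut ep (X ∩ C) g
        then w g else 0) ≤ (2 / t) * ((if (ep g).1 ∈ X' ∧ (ep g).2 ∈ X' then x g else 0) -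
          ∑ C ∈ R, if (ep g).1 ∈ C ∧ (ep g).2 ∈ C then x g else 0) := by
      intro g
      have hxg := hx.1 g
      by_cases hg : M (ep g).1 = M (ep g).2
      · have e1 : (∑ C ∈ R, if (ep g).1 ∈ X ∧ (ep g).2 ∈ X ∧ crossesCut ep (X ∩ C) g
            then w g else 0) = 0 := by
          refine Finset.sum_eq_zero fun C hC => if_neg ?_
          rintro ⟨a, b, h⟩
          unfold crossesCut at h
          simp only [Finset.mem_inter, hRd C hC, hg] at h
          tauto
        rw [e1]
        refine mul_nonneg (by positivity) ?_
        have e2 : (∑ C ∈ R, if (ep g).1 ∈ C ∧ (ep g).2 ∈ C then x g else 0) =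
            ∑ C ∈ R, if M (ep g).2 = C then x g else 0 := by
          refine Finset.sum_congr rfl fun C hC => ?_
          simp only [hRd C hC, hg, and_self]
        rw [e2, Finset.sum_ite_eq]
        split_ifs with h1 h2 h2
        · simp
        · simpa using hxg
        · exact absurd ⟨Finset.mem_biUnion.2 ⟨_, h2, by simp [← hg, hMv]⟩,
            Finset.mem_biUnion.2 ⟨_, h2, hMv _⟩⟩ h1
        · simp
      · have e2 : (∑ C ∈ R, if (ep g).1 ∈ C ∧ (ep g).2 ∈ C then x g else 0) = 0 := by
          refine Finset.sum_eq_zero fun C hC => if_neg ?_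
          rintro ⟨a, b⟩
          rw [hRd C hC] at a b
          exact hg (a.trans b.symm)
        rw [e2, sub_zero]
        have hl := hcross g hg
        have hwg : w g ≤ x g / t := by
          rw [hw]; exact div_le_div_of_nonneg_left hxg htpos hl
        have hwg0 : 0 ≤ w g := by
          rw [hw]; exact div_nonneg hxg (htpos.le.trans hl)
        by_cases hgX : (ep g).1 ∈ X ∧ (ep g).2 ∈ X
        · rw [if_pos ⟨hX'X hgX.1, hX'X hgX.2⟩]
          have : (∑ C ∈ R, if (ep g).1 ∈ X ∧ (ep g).2 ∈ X ∧ crossesCut ep (X ∩ C) g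
            then w g else 0) ≤ ∑ C ∈ R, ((if M (ep g).1 = C then w g else 0) +
              (if M (ep g).2 = C then w g else 0)) := by
            refine Finset.sum_le_sum fun C hC => ?_
            unfold crossesCut
            simp only [Finset.mem_inter, hRd C hC, hgX.1, hgX.2, true_and]
            by_cases p : M (ep g).1 = C <;> by_cases q : M (ep g).2 = C <;> simp [p, q, hwg0]
          refine this.trans ?_
          rw [Finset.sum_add_distrib, Finset.sum_ite_eq, Finset.sum_ite_eq]
          have : 2 / t * x g = x g / t + x g / t := by ring
          rw [this]
          refine add_le_add ?_ ?_ <;> split_ifs <;> linarith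
        · have e1 : (∑ C ∈ R, if (ep g).1 ∈ X ∧ (ep g).2 ∈ X ∧ crossesCut ep (X ∩ C) g
            then w g else 0) = 0 :=
            Finset.sum_eq_zero fun C hC => if_neg fun h => hgX ⟨h.1, h.2.1⟩
          rw [e1]
          refine mul_nonneg (by positivity) ?_
          split_ifs
          exacts [hxg, le_rfl]
    unfold cutWt xin
    rw [Finset.sum_comm, Finset.sum_comm (s := R), ← Finset.sum_sub_distrib, Finset.mul_sum]
    exact Finset.sum_le_sum fun g _ => hper g
  have htight : ∑ C ∈ R, xin ep x C = ∑ C ∈ R, ((C.card : ℝ) - 1) := by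
    refine Finset.sum_congr rfl fun C hC => ?_
    obtain ⟨u, hu, rfl⟩ := Finset.mem_image.1 hC
    exact (hMg u).1.2
  have hsum : ∑ C ∈ R, cutWt ep w X (X ∩ C) ≤ ∑ C ∈ R, 2 / t := by
    refine hmain.trans ?_
    rw [Finset.sum_const, nsmul_eq_mul, mul_comm (R.card : ℝ)]
    refine mul_le_mul_of_nonneg_left ?_ (by positivity)
    rw [htight, Finset.sum_sub_distrib, ← hcard]
    simp only [Finset.sum_const, nsmul_eq_mul, mul_one]
    linarith
  obtain ⟨C, hC, hle⟩ := Finset.exists_le_of_sum_le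
    ⟨_, Finset.mem_image_of_mem M hX.1⟩ hsum
  refine ⟨X ∩ C, Finset.inter_subset_left, ?_, ?_, hle⟩
  · obtain ⟨u, hu, rfl⟩ := Finset.mem_image.1 hC
    exact ⟨u, by simp [hu, hMv]⟩
  · intro h
    have hsub : X ⊆ C := Finset.inter_eq_left.1 h
    exact hfM (((hRd C hC _).1 (hsub hX.1)).trans ((hRd C hC _).1 (hsub hX.2)).symm)

lemma generic (ep : F → V × V) (hne : ∀ f, (ep f).1 ≠ (ep f).2) (own : F → E)
    (hown : Function.Surjective own) :
    ∃ w : F → ℝ, (∀ f, 0 ≤ w f) ∧ (∀ e, (∑ f, if own f = e then w f else 0) = 1) ∧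
      ∃ t : E → ℝ, (∀ e, 0 < t e) ∧ ∀ f, 1 / t (own f) ≤ strength ep w f ∧
        (0 < w f → strength ep w f ≤ 2 / t (own f)) := by
  obtain ⟨x, hx, hopt⟩ := exists_opt ep hne own
  have hpos : ∀ e, 0 < load own x e := by
    intro e
    obtain ⟨f, rfl⟩ := hown e
    exact load_pos ep hne own x hx hopt f
  have hD := exists_tight ep own x hx hopt
  have hw0 : ∀ f, 0 ≤ x f / load own x (own f) := fun f => div_nonneg (hx.1 f) (hpos _).le
  refine ⟨fun f => x f / load own x (own f), hw0, fun e => ?_, load own x, hpos, fun f => ⟨?_, ?_⟩⟩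
  · have : (∑ f, if own f = e then x f / load own x (own f) else 0) =
        load own x e / load own x e := by
      conv_rhs => rw [load, Finset.sum_div]
      refine Finset.sum_congr rfl fun f _ => ?_
      split_ifs with h
      · rw [h]; rfl
      · simp
    rw [this, div_self (hpos e).ne']
  · obtain ⟨D, h1, h2, h3⟩ := hD f
    refine le_strength ep _ f (hne f) D h2 _ fun S a b c => ?_
    have hcut := tight_cut ep x hx D h1 S a b c
    have : cutWt ep x D S / load own x (own f) ≤
        cutWt ep (fun f => x f / load own x (own f)) D S := by
      unfold cutWt
      rw [Finset.sum_div]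
      refine Finset.sum_le_sum fun g _ => ?_
      split_ifs with h
      · rcases (hx.1 g).eq_or_lt with h0 | h0
        · simp [← h0]
        · exact div_le_div_of_nonneg_left h0.le (hpos _) (h3 g h0 ⟨h.1, h.2.1⟩)
      · simp
    exact (div_le_div_of_nonneg_right hcut (hpos _).le).trans this
  · intro hwf
    have hxf : 0 < x f := by
      rcases (hx.1 f).eq_or_lt with h0 | h0
      · simp [← h0] at hwf
      · exact h0
    refine strength_le ep _ hw0 f _ (div_nonneg zero_le_two (hpos _).le) fun X hX => ?_
    exact exists_small_cut ep hne own x hx hD _ (fun _ => rfl) f hxf X hX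

end

end Bal


/-- Every unweighted finite multi-hypergraph all of whose hyperedges have at
least 2 vertices admits, for every integer `γ ≥ 2`, a `γ`-balanced weight assignment. -/
theorem stmt2 {V E : Type} [Fintype V] [LinearOrder V] [Fintype E]
    (he : E → Finset V) (hhe : ∀ e, 2 ≤ (he e).card)
    (γ : ℕ) (hγ : 2 ≤ γ) :
    ∃ w : CliqueEdges he → ℝ, (∀ f, 0 ≤ w f) ∧ BalancedAssignment he w (γ : ℝ) := by
  obtain ⟨w, hw, hsum, t, ht, hst⟩ := Bal.generic (cep he) (fun f => f.2.2.2.ne)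
    (fun f : CliqueEdges he => f.1.1) (by
      intro e
      obtain ⟨a, ha, b, hb, hab⟩ := Finset.one_lt_card.1 (hhe e)
      rcases lt_or_gt_of_ne hab with h | h
      · exact ⟨⟨(e, a, b), ha, hb, h⟩, rfl⟩
      · exact ⟨⟨(e, b, a), hb, ha, h⟩, rfl⟩)
  refine ⟨w, hw, fun e => ⟨?_, ?_⟩⟩
  · convert hsum e
  · have h1 : kappaMax he w e ≤ 2 / t e := by
      refine Real.sSup_le ?_ (div_nonneg zero_le_two (ht e).le)
      rintro _ ⟨f, rfl, hf, rfl⟩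
      exact (hst f).2 hf
    have h2 : 1 / t e ≤ kappa he w e := by
      refine le_csInf ?_ ?_
      · obtain ⟨a, ha, b, hb, hab⟩ := Finset.one_lt_card.1 (hhe e)
        rcases lt_or_gt_of_ne hab with h | h
        · exact ⟨_, ⟨(e, a, b), ha, hb, h⟩, rfl, rfl⟩
        · exact ⟨_, ⟨(e, b, a), hb, ha, h⟩, rfl, rfl⟩
      · rintro _ ⟨f, rfl, rfl⟩
        exact (hst f).1
    have h3 : (2:ℝ) ≤ γ := by exact_mod_cast hγ
    have h4 : 0 < 1 / t e := one_div_pos.2 (ht e)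
    have h5 : 2 / t e = 2 * (1 / t e) := by ring
    rw [h5] at h1
    exact h1.trans (mul_le_mul h3 h2 h4.le (by linarith))
end

section
/- Let w^F be a γ-balanced weight assignment of an unweighted multi-hypergraph H = (V, E) with |V| = n ≥ 2 (every hyperedge of size at least 2), let ε ∈ (0,1], let d ≥ 1 be an integer, set ρ := 8(d+6)γ²·(log n)/(0.38·ε²), and for each e ∈ E set p_e := min(1, ρ/κ_e). Include each hyperedge e ∈ E in Ê independently with probability p_e, and give each included hyperedge weight ŵ(e) := 1/p_e. Then with probability at least 1 − 4n^{−d}, for every cut ∅ ⊊ S ⊊ V one has |ŵ(δ_Ĥ(S)) − |δ_H(S)|| ≤ 2ε·|δ_H(S)|, where Ĥ = (V, Ê, ŵ). Moreover, the expected number of hyperedges in Ê is at most ρ·γ·(n − 1). -/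
open Finset
open scoped Classical

/-- The probability that the independent sampling with inclusion probabilities `p` produces
exactly the set `A` of hyperedges. -/
noncomputable def sampleProb {E : Type} [Fintype E] [DecidableEq E]
    (p : E → ℝ) (A : Finset E) : ℝ :=
  (∏ e ∈ A, p e) * ∏ e ∈ Aᶜ, (1 - p e)


section helpers

variable {V F : Type} [Fintype F]

def strongSet (ep : F → V × V) (w : F → ℝ) (t : ℝ) (X : Finset V) : Prop :=
  ∀ S : Finset V, (∃ a ∈ X, a ∈ S) → (∃ b ∈ X, b ∉ S) → t ≤ cutWt ep w X S

lemma cutWt_congr (ep : F → V × V) (w : F → ℝ) (X S T : Finset V)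
    (h : ∀ x ∈ X, (x ∈ S ↔ x ∈ T)) : cutWt ep w X S = cutWt ep w X T := by
  unfold cutWt
  apply Finset.sum_congr rfl
  intro f _
  by_cases h1 : (ep f).1 ∈ X
  · by_cases h2 : (ep f).2 ∈ X
    · have a1 := h _ h1
      have a2 := h _ h2
      refine if_congr ?_ rfl rfl
      simp only [crossesCut, a1, a2]
    · simp [h2]
  · simp [h1]

lemma cutWt_mono (ep : F → V × V) (w : F → ℝ) (hw : ∀ f, 0 ≤ w f) (X Y S : Finset V)
    (h : X ⊆ Y) : cutWt ep w X S ≤ cutWt ep w Y S := by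
  unfold cutWt
  apply Finset.sum_le_sum
  intro f _
  by_cases h1 : (ep f).1 ∈ X ∧ (ep f).2 ∈ X ∧ crossesCut ep S f
  · rw [if_pos h1, if_pos ⟨h h1.1, h h1.2.1, h1.2.2⟩]
  · rw [if_neg h1]
    split_ifs
    · exact hw f
    · exact le_rfl

lemma cutWt_nonneg (ep : F → V × V) (w : F → ℝ) (hw : ∀ f, 0 ≤ w f) (X S : Finset V) :
    0 ≤ cutWt ep w X S := by
  unfold cutWt
  apply Finset.sum_nonneg
  intro f _
  split_ifs
  · exact hw f
  · exact le_rfl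

lemma le_minCutIn (ep : F → V × V) (w : F → ℝ) (t : ℝ) (X : Finset V)
    (hX : strongSet ep w t X) {a b : V} (ha : a ∈ X) (hb : b ∈ X) (hab : a ≠ b) :
    t ≤ minCutIn ep w X := by
  unfold minCutIn
  apply le_csInf
  · refine ⟨_, {a}, ?_, ⟨a, by simp⟩, ?_, rfl⟩
    · simpa using ha
    · intro h
      rw [← h] at hb
      simp at hb
      exact hab hb.symm
  · rintro c ⟨S, hS, ⟨x, hx⟩, hne, rfl⟩
    apply hX S ⟨x, hS hx, hx⟩
    by_contra hcon
    push Not at hcon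
    exact hne (Finset.Subset.antisymm hS hcon)

variable [Fintype V]

lemma le_strength (ep : F → V × V) (w : F → ℝ) (t : ℝ) (X : Finset V) (f : F)
    (hX : strongSet ep w t X) (h1 : (ep f).1 ∈ X) (h2 : (ep f).2 ∈ X)
    (hne : (ep f).1 ≠ (ep f).2) : t ≤ strength ep w f := by
  refine (le_minCutIn ep w t X hX h1 h2 hne).trans ?_
  unfold strength
  apply le_csSup
  · apply Set.Finite.bddAbove
    apply (Set.finite_range (fun X : Finset V => minCutIn ep w X)).subset
    rintro c ⟨X, _, _, rfl⟩
    exact ⟨X, rfl⟩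
  · exact ⟨X, h1, h2, rfl⟩

lemma exists_strong (ep : F → V × V) (w : F → ℝ) (f : F) :
    ∃ Y : Finset V, (ep f).1 ∈ Y ∧ (ep f).2 ∈ Y ∧ strongSet ep w (strength ep w f) Y := by
  have hmem : strength ep w f ∈ {c : ℝ | ∃ X : Finset V, (ep f).1 ∈ X ∧ (ep f).2 ∈ X ∧
      c = minCutIn ep w X} := by
    unfold strength
    apply Set.Nonempty.csSup_mem
    · exact ⟨_, Finset.univ, by simp, by simp, rfl⟩
    · apply (Set.finite_range (fun X : Finset V => minCutIn ep w X)).subset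
      rintro c ⟨X, _, _, rfl⟩
      exact ⟨X, rfl⟩
  obtain ⟨Y, h1, h2, h3⟩ := hmem
  refine ⟨Y, h1, h2, ?_⟩
  rintro S ⟨a, haY, haS⟩ ⟨b, hbY, hbS⟩
  rw [h3, cutWt_congr ep w Y S (Y.filter (· ∈ S)) (by intro x hx; simp [hx])]
  unfold minCutIn
  apply csInf_le
  · apply Set.Finite.bddBelow
    apply (Set.finite_range (fun S : Finset V => cutWt ep w Y S)).subset
    rintro c ⟨S, _, _, _, rfl⟩
    exact ⟨S, rfl⟩
  · refine ⟨_, Finset.filter_subset _ _, ⟨a, by simp [haY, haS]⟩, ?_, rfl⟩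
    intro h
    rw [← h] at hbY
    simp at hbY
    exact hbS hbY.2

noncomputable def comp (ep : F → V × V) (w : F → ℝ) (t : ℝ) (u : V) : Finset V :=
  Finset.univ.filter (fun v => ∃ X : Finset V, strongSet ep w t X ∧ u ∈ X ∧ v ∈ X)

lemma mem_comp (ep : F → V × V) (w : F → ℝ) (t : ℝ) (u v : V) :
    v ∈ comp ep w t u ↔ ∃ X : Finset V, strongSet ep w t X ∧ u ∈ X ∧ v ∈ X := by
  simp [comp]

lemma self_mem_comp (ep : F → V × V) (w : F → ℝ) (t : ℝ) (u : V) : u ∈ comp ep w t u := by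
  rw [mem_comp]
  refine ⟨{u}, ?_, by simp, by simp⟩
  rintro S ⟨a, ha, ha'⟩ ⟨b, hb, hb'⟩
  simp at ha hb
  subst ha hb
  exact absurd ha' hb'

lemma subset_comp (ep : F → V × V) (w : F → ℝ) (t : ℝ) (u : V) (X : Finset V)
    (hX : strongSet ep w t X) (hu : u ∈ X) : X ⊆ comp ep w t u := by
  intro v hv
  rw [mem_comp]
  exact ⟨X, hX, hu, hv⟩

lemma comp_strong (ep : F → V × V) (w : F → ℝ) (hw : ∀ f, 0 ≤ w f) (t : ℝ) (u : V) :
    strongSet ep w t (comp ep w t u) := by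
  rintro S ⟨a, ha, ha'⟩ ⟨b, hb, hb'⟩
  by_cases hu : u ∈ S
  · obtain ⟨X, hX, hu1, hb1⟩ := (mem_comp ep w t u b).1 hb
    exact (hX S ⟨u, hu1, hu⟩ ⟨b, hb1, hb'⟩).trans
      (cutWt_mono ep w hw _ _ _ (subset_comp ep w t u X hX hu1))
  · obtain ⟨X, hX, hu1, ha1⟩ := (mem_comp ep w t u a).1 ha
    exact (hX S ⟨a, ha1, ha'⟩ ⟨u, hu1, hu⟩).trans
      (cutWt_mono ep w hw _ _ _ (subset_comp ep w t u X hX hu1))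

lemma comp_eq (ep : F → V × V) (w : F → ℝ) (hw : ∀ f, 0 ≤ w f) (t : ℝ) (u v : V)
    (h : v ∈ comp ep w t u) : comp ep w t v = comp ep w t u := by
  have h1 := subset_comp ep w t v _ (comp_strong ep w hw t u) h
  apply Finset.Subset.antisymm _ h1
  exact subset_comp ep w t u _ (comp_strong ep w hw t v) (h1 (self_mem_comp ep w t u))

lemma mem_comp_iff (ep : F → V × V) (w : F → ℝ) (hw : ∀ f, 0 ≤ w f) (t : ℝ) (f : F)
    (hne : (ep f).1 ≠ (ep f).2) :
    (ep f).2 ∈ comp ep w t (ep f).1 ↔ t ≤ strength ep w f := by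
  constructor
  · intro h
    exact le_strength ep w t _ f (comp_strong ep w hw t _) (self_mem_comp ep w t _) h hne
  · intro h
    obtain ⟨Y, h1, h2, h3⟩ := exists_strong ep w f
    rw [mem_comp]
    exact ⟨Y, fun S ha hb => h.trans (h3 S ha hb), h1, h2⟩

/-- Strength-scaled weights have min-cut at least one inside strong components. -/
lemma nu_ge_one (ep : F → V × V) (w : F → ℝ) (hw : ∀ f, 0 ≤ w f)
    (hne : ∀ f, (ep f).1 ≠ (ep f).2) (t : ℝ) (ht : 0 < t) (u : V) :
    strongSet ep (fun f => w f / strength ep w f) 1 (comp ep w t u) := by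
  intro S ha hb
  set X := comp ep w t u with hXdef
  have hXs : strongSet ep w t X := comp_strong ep w hw t u
  have h0 : 0 < cutWt ep w X S := ht.trans_le (hXs S ha hb)
  set T := Finset.univ.filter (fun f => (ep f).1 ∈ X ∧ (ep f).2 ∈ X ∧ crossesCut ep S f) with hT
  have hTne : T.Nonempty := by
    by_contra hcon
    rw [Finset.not_nonempty_iff_eq_empty] at hcon
    unfold cutWt at h0
    rw [← Finset.sum_filter] at h0
    rw [← hT, hcon] at h0
    simp at h0
  obtain ⟨f, hf, hmax⟩ := Finset.exists_max_image T (fun f => strength ep w f) hTne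
  have hf' : (ep f).1 ∈ X ∧ (ep f).2 ∈ X ∧ crossesCut ep S f := by simpa [hT] using hf
  set k := strength ep w f with hk
  have hkt : t ≤ k := le_strength ep w t X f hXs hf'.1 hf'.2.1 (hne f)
  have hkpos : 0 < k := ht.trans_le hkt
  obtain ⟨Y, hY1, hY2, hYs⟩ := exists_strong ep w f
  have hYX : Y ⊆ X := by
    have := subset_comp ep w t (ep f).1 Y (fun S ha hb => hkt.trans (hYs S ha hb)) hY1
    rwa [comp_eq ep w hw t u _ hf'.1] at this
  have hcut : k ≤ cutWt ep w Y S := by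
    rcases hf'.2.2 with h | h
    · exact hYs S ⟨_, hY1, h.1⟩ ⟨_, hY2, h.2⟩
    · exact hYs S ⟨_, hY2, h.2⟩ ⟨_, hY1, h.1⟩
  have : cutWt ep w Y S / k ≤ cutWt ep (fun f => w f / strength ep w f) X S := by
    unfold cutWt
    rw [Finset.sum_div]
    apply Finset.sum_le_sum
    intro g _
    by_cases h1 : (ep g).1 ∈ Y ∧ (ep g).2 ∈ Y ∧ crossesCut ep S g
    · have hgX : (ep g).1 ∈ X ∧ (ep g).2 ∈ X ∧ crossesCut ep S g := ⟨hYX h1.1, hYX h1.2.1, h1.2.2⟩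
      rw [if_pos h1, if_pos hgX]
      have hgk : strength ep w g ≤ k := hmax g (by simpa [hT] using hgX)
      have hgt : t ≤ strength ep w g := le_strength ep w t X g hXs hgX.1 hgX.2.1 (hne g)
      exact div_le_div_of_nonneg_left (hw g) (ht.trans_le hgt) hgk
    · rw [if_neg h1]
      by_cases hgX : (ep g).1 ∈ X ∧ (ep g).2 ∈ X ∧ crossesCut ep S g
      · rw [if_pos hgX]
        have hgt : t ≤ strength ep w g := le_strength ep w t X g hXs hgX.1 hgX.2.1 (hne g)
        simp only [zero_div]
        exact div_nonneg (hw g) (ht.le.trans hgt)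
      · rw [if_neg hgX]; simp
  refine le_trans ?_ this
  rw [le_div_iff₀ hkpos]
  linarith

/-- Benczúr–Karger: the strength-scaled total weight is at most `|X| - 1`. -/
lemma sum_div_strength (ep : F → V × V) (w : F → ℝ) (hw : ∀ f, 0 ≤ w f)
    (hne : ∀ f, (ep f).1 ≠ (ep f).2) (hpos : ∀ f, 0 < strength ep w f) :
    ∀ (m : ℕ) (X : Finset V), X.card = m → X.Nonempty →
      (∑ f : F, if (ep f).1 ∈ X ∧ (ep f).2 ∈ X then w f / strength ep w f else 0)
        ≤ (X.card : ℝ) - 1 := by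
  intro m
  induction m using Nat.strong_induction_on with
  | _ m ih =>
  intro X hXm hXne
  by_cases h1 : X.card = 1
  · obtain ⟨x, rfl⟩ := Finset.card_eq_one.1 h1
    simp only [Finset.card_singleton, Nat.cast_one, sub_self]
    apply Finset.sum_nonpos
    intro f _
    rw [if_neg]
    simp only [Finset.mem_singleton]
    rintro ⟨a, b⟩
    exact hne f (a.trans b.symm)
  · have h2 : 1 < X.card := by
      have := hXne.card_pos
      omega
    set P := X.powerset.filter (fun S => S.Nonempty ∧ S ≠ X) with hP
    have hPne : P.Nonempty := by
      obtain ⟨a, ha, b, hb, hab⟩ := Finset.one_lt_card.1 h2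
      refine ⟨{a}, ?_⟩
      simp only [hP, Finset.mem_filter, Finset.mem_powerset, Finset.singleton_subset_iff,
        Finset.singleton_nonempty, true_and]
      refine ⟨ha, ?_⟩
      intro h
      rw [← h] at hb
      simp at hb
      exact hab hb.symm
    obtain ⟨S, hS, hmin⟩ := Finset.exists_min_image P (fun S => cutWt ep w X S) hPne
    simp only [hP, Finset.mem_filter, Finset.mem_powerset] at hS
    obtain ⟨hSX, hSne, hSneX⟩ := hS
    set c := cutWt ep w X S with hc
    have hXs : strongSet ep w c X := by
      rintro T ⟨a, ha, ha'⟩ ⟨b, hb, hb'⟩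
      rw [cutWt_congr ep w X T (X.filter (· ∈ T)) (by intro x hx; simp [hx])]
      apply hmin
      simp only [hP, Finset.mem_filter, Finset.mem_powerset]
      refine ⟨Finset.filter_subset _ _, ⟨a, by simp [ha, ha']⟩, ?_⟩
      intro h
      rw [← h] at hb
      simp at hb
      exact hb' hb.2
    have hSlt : S.card < X.card := Finset.card_lt_card (hSX.ssubset_of_ne hSneX)
    set R := X \ S with hR
    have hcardR : R.card + S.card = X.card := Finset.card_sdiff_add_card_eq_card hSX
    have hSpos := hSne.card_pos
    have hRne : R.Nonempty := by
      rw [← Finset.card_pos]; omega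
    have iS := ih S.card (by omega) S rfl hSne
    have iR := ih R.card (by omega) R rfl hRne
    have hcross : cutWt ep (fun f => w f / strength ep w f) X S ≤ 1 := by
      have hc0 : 0 ≤ c := cutWt_nonneg ep w hw X S
      have : cutWt ep (fun f => w f / strength ep w f) X S * c ≤ c := by
        conv_rhs => rw [hc]
        unfold cutWt
        rw [Finset.sum_mul]
        apply Finset.sum_le_sum
        intro f _
        split_ifs with h
        · have := le_strength ep w c X f hXs h.1 h.2.1 (hne f)
          rw [div_mul_eq_mul_div, div_le_iff₀ (hpos f)]
          exact mul_le_mul_of_nonneg_left this (hw f)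
        · simp
      rcases hc0.lt_or_eq with h | h
      · nlinarith
      · have : cutWt ep (fun f => w f / strength ep w f) X S = 0 := by
          have hz : ∑ f : F, (if (ep f).1 ∈ X ∧ (ep f).2 ∈ X ∧ crossesCut ep S f then w f else 0) = 0 :=
            h.symm
          rw [Finset.sum_eq_zero_iff_of_nonneg] at hz
          · unfold cutWt
            apply Finset.sum_eq_zero
            intro f hf
            have := hz f hf
            split_ifs with h
            · rw [if_pos h] at this
              simp [this]
            · rfl
          · intro f _
            split_ifs
            · exact hw f
            · exact le_rfl
        rw [this]; norm_num
    have hsplit : (∑ f : F, if (ep f).1 ∈ X ∧ (ep f).2 ∈ X then w f / strength ep w f else 0)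
        ≤ (∑ f : F, if (ep f).1 ∈ S ∧ (ep f).2 ∈ S then w f / strength ep w f else 0)
        + (∑ f : F, if (ep f).1 ∈ R ∧ (ep f).2 ∈ R then w f / strength ep w f else 0)
        + cutWt ep (fun f => w f / strength ep w f) X S := by
      unfold cutWt
      rw [← Finset.sum_add_distrib, ← Finset.sum_add_distrib]
      apply Finset.sum_le_sum
      intro f _
      have hq : 0 ≤ w f / strength ep w f := div_nonneg (hw f) (hpos f).le
      by_cases a1 : (ep f).1 ∈ X <;> by_cases a2 : (ep f).2 ∈ X <;>
        by_cases b1 : (ep f).1 ∈ S <;> by_cases b2 : (ep f).2 ∈ S <;>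
        simp [a1, a2, b1, b2, hR, crossesCut, hq]
    have : (R.card : ℝ) + S.card = X.card := by exact_mod_cast hcardR
    linarith

end helpers

section counting

variable {V F : Type} [Fintype F]

noncomputable def contr (ep : F → V × V) (u v : V) : F → V × V :=
  fun f => (if (ep f).1 = v then u else (ep f).1, if (ep f).2 = v then u else (ep f).2)

lemma contr_cut (ep : F → V × V) (w : F → ℝ) (X S : Finset V) (u v : V) (huv : u ≠ v)
    (hu : u ∈ X) (hv : v ∈ X) (h : u ∈ S ↔ v ∈ S) :
    cutWt (contr ep u v) w (X.erase v) S = cutWt ep w X S := by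
  unfold cutWt
  apply Finset.sum_congr rfl
  intro f _
  congr 1
  simp only [contr, crossesCut, Finset.mem_erase, eq_iff_iff]
  by_cases h1 : (ep f).1 = v <;> by_cases h2 : (ep f).2 = v <;> simp [h1, h2, huv, hu, hv, h]

lemma exp_step (m ν W : ℝ) (hm : 2 ≤ m) (hν : 0 ≤ ν) (hW : m ≤ 2 * W) (hνW : ν ≤ W / 2) :
    Real.exp (-(24 * Real.log m * ν)) ≤
      Real.exp (-(24 * Real.log (m - 1) * ν)) * ((W - ν) / W) := by
  have hWpos : 0 < W := by linarith
  have h1 : 1 / m ≤ Real.log m - Real.log (m - 1) := by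
    have := Real.log_le_sub_one_of_pos (x := (m - 1) / m) (by apply div_pos <;> linarith)
    rw [Real.log_div (by linarith) (by linarith)] at this
    have e : (m - 1) / m - 1 = - (1 / m) := by
      have : m ≠ 0 := by linarith
      field_simp; ring
    linarith
  have h2 : Real.exp (-(2 * (ν / W))) ≤ (W - ν) / W := by
    have hy0 : 0 ≤ ν / W := div_nonneg hν hWpos.le
    have hy1 : ν / W ≤ 1 / 2 := by
      rw [div_le_iff₀ hWpos]; linarith
    have e : (W - ν) / W = 1 - ν / W := by field_simp
    rw [e, Real.exp_neg]
    set y := ν / W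
    have := Real.add_one_le_exp (2 * y)
    apply inv_le_of_inv_le₀ (by linarith)
    refine le_trans ?_ this
    rw [inv_le_iff_one_le_mul₀ (by linarith)]
    nlinarith
  refine le_trans ?_ (mul_le_mul_of_nonneg_left h2 (Real.exp_pos _).le)
  rw [← Real.exp_add]
  apply Real.exp_le_exp.2
  have h3 : ν / W ≤ 2 * (1 / m) * ν := by
    rw [div_le_iff₀ hWpos]
    have : 1 ≤ 2 * (1 / m) * W := by
      rw [mul_one_div, div_mul_eq_mul_div, le_div_iff₀ (by linarith)]; linarith
    nlinarith
  have h4 : 1 / m * ν ≤ (Real.log m - Real.log (m - 1)) * ν := mul_le_mul_of_nonneg_right h1 hν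
  have h5 : 0 ≤ 1 / m * ν := mul_nonneg (by positivity) hν
  nlinarith

lemma big_step (m : ℕ) (hm : 2 ≤ m) :
    (2 : ℝ) ^ m * Real.exp (-(24 * Real.log m * (m / 4))) ≤ 1 / ((m : ℝ) - 1) - 1 / m := by
  have hm' : (2 : ℝ) ≤ m := by exact_mod_cast hm
  have hl : Real.log 2 ≤ Real.log m := Real.log_le_log (by norm_num) hm'
  have hl2 : 0 < Real.log 2 := Real.log_pos (by norm_num)
  have e1 : (2 : ℝ) ^ m = Real.exp (m * Real.log 2) := by
    rw [mul_comm, Real.exp_mul, Real.exp_log (by norm_num), Real.rpow_natCast]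
  rw [e1, ← Real.exp_add]
  have : Real.exp (m * Real.log 2 + -(24 * Real.log m * (m / 4))) ≤ Real.exp (-(2 * Real.log m)) := by
    apply Real.exp_le_exp.2
    nlinarith
  refine this.trans ?_
  rw [Real.exp_neg, two_mul, Real.exp_add, Real.exp_log (by linarith)]
  rw [div_sub_div _ _ (by linarith) (by linarith), inv_eq_one_div]
  have : (1 * (m : ℝ) - (m - 1) * 1) = 1 := by ring
  rw [this]
  apply one_div_le_one_div_of_le
  · apply mul_pos <;> linarith
  · nlinarith

lemma count_cuts (m : ℕ) : ∀ (X : Finset V) (ep : F → V × V) (w : F → ℝ), X.card = m + 1 →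
    (∀ f, 0 ≤ w f) → strongSet ep w 1 X →
    ∑ S ∈ X.powerset.filter (fun S => S.Nonempty ∧ S ≠ X),
      Real.exp (-(24 * Real.log ((m + 1 : ℕ) : ℝ) * cutWt ep w X S)) ≤ 1 - 1 / ((m + 1 : ℕ) : ℝ) := by
  induction m with
  | zero =>
    intro X ep w hX hw hs
    obtain ⟨x, rfl⟩ := Finset.card_eq_one.1 hX
    rw [Finset.filter_false_of_mem]
    · simp
    · rintro S hS ⟨h1, h2⟩
      rw [Finset.mem_powerset, Finset.subset_singleton_iff] at hS
      rcases hS with h | h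
      · simp [h] at h1
      · exact h2 h
  | succ m ih =>
    intro X ep w hX hw hs
    set M : ℝ := ((m + 1 + 1 : ℕ) : ℝ) with hM
    have hM2 : 2 ≤ M := by rw [hM]; push_cast; linarith [Nat.cast_nonneg (α := ℝ) m]
    have hM1 : ((m + 1 : ℕ) : ℝ) = M - 1 := by rw [hM]; push_cast; ring
    rw [hM1] at ih
    set N := X.powerset.filter (fun S => S.Nonempty ∧ S ≠ X) with hN
    set W : ℝ := ∑ f : F, if (ep f).1 ∈ X ∧ (ep f).2 ∈ X ∧ (ep f).1 ≠ (ep f).2 then w f else 0 with hW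
    have hdeg : M ≤ 2 * W := by
      have h1 : (∑ x ∈ X, cutWt ep w X {x}) ≤ 2 * W := by
        unfold cutWt
        rw [Finset.sum_comm, hW, Finset.mul_sum]
        apply Finset.sum_le_sum
        intro f _
        by_cases hf : (ep f).1 ∈ X ∧ (ep f).2 ∈ X ∧ (ep f).1 ≠ (ep f).2
        · rw [if_pos hf]
          have : ∀ x ∈ X, (if (ep f).1 ∈ X ∧ (ep f).2 ∈ X ∧ crossesCut ep {x} f then w f else 0)
              ≤ (if x = (ep f).1 then w f else 0) + (if x = (ep f).2 then w f else 0) := by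
            intro x hx
            have := hw f
            by_cases hc : crossesCut ep {x} f
            · rw [if_pos ⟨hf.1, hf.2.1, hc⟩]
              simp only [crossesCut, Finset.mem_singleton] at hc
              rcases hc with h | h
              · rw [if_pos h.1.symm]
                split_ifs <;> linarith
              · rw [if_pos h.2.symm]
                split_ifs <;> linarith
            · rw [if_neg (by tauto)]
              split_ifs <;> linarith
          refine (Finset.sum_le_sum this).trans ?_
          rw [Finset.sum_add_distrib, Finset.sum_ite_eq', Finset.sum_ite_eq', if_pos hf.1,
            if_pos hf.2.1]
          linarith
        · rw [if_neg hf, mul_zero]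
          apply Finset.sum_nonpos
          intro x hx
          rw [if_neg]
          rintro ⟨a, b, c⟩
          apply hf
          refine ⟨a, b, ?_⟩
          intro hh
          simp only [crossesCut, hh] at c
          tauto
      have h2 : (∑ x ∈ X, (1 : ℝ)) ≤ ∑ x ∈ X, cutWt ep w X {x} := by
        apply Finset.sum_le_sum
        intro x hx
        have : ∃ b ∈ X, b ≠ x := by
          apply Finset.exists_mem_ne (by omega)
        obtain ⟨b, hb, hbx⟩ := this
        exact hs {x} ⟨x, hx, by simp⟩ ⟨b, hb, by simpa using hbx⟩
      simp only [Finset.sum_const, nsmul_eq_mul, mul_one, hX] at h2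
      linarith
    have hWpos : 0 < W := by linarith
    -- contraction
    have hcon : ∀ f, (ep f).1 ∈ X → (ep f).2 ∈ X → (ep f).1 ≠ (ep f).2 →
        ∑ S ∈ N.filter (fun S => ¬ crossesCut ep S f),
          Real.exp (-(24 * Real.log (M - 1) * cutWt ep w X S)) ≤ 1 - 1 / (M - 1) := by
      intro f h1 h2 hne
      set u := (ep f).1 with hu
      set v := (ep f).2 with hv
      have hcard : (X.erase v).card = m + 1 := by
        rw [Finset.card_erase_of_mem h2, hX]; rfl
      have hiff : ∀ S : Finset V, ¬ crossesCut ep S f ↔ (u ∈ S ↔ v ∈ S) := by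
        intro S
        simp only [crossesCut, ← hu, ← hv]
        tauto
      have hs' : strongSet (contr ep u v) w 1 (X.erase v) := by
        rintro S ⟨a, ha, ha'⟩ ⟨b, hb, hb'⟩
        rw [Finset.mem_erase] at ha hb
        set S' : Finset V := (insert v S).filter (fun x => x = v → u ∈ S) with hS'
        have hmem : ∀ x, x ∈ S' ↔ (x = v ∧ u ∈ S) ∨ (x ≠ v ∧ x ∈ S) := by
          intro x
          simp only [hS', Finset.mem_filter, Finset.mem_insert]
          tauto
        rw [cutWt_congr _ w _ S S', contr_cut ep w X S' u v hne h1 h2]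
        · apply hs
          · exact ⟨a, ha.2, by rw [hmem]; tauto⟩
          · exact ⟨b, hb.2, by rw [hmem]; tauto⟩
        · rw [hmem, hmem]; tauto
        · intro x hx
          rw [Finset.mem_erase] at hx
          rw [hmem]; tauto
      have hih := ih (X.erase v) (contr ep u v) w hcard hw hs'
      refine le_trans ?_ hih
      have hinj : Set.InjOn (fun S : Finset V => S.erase v)
          (N.filter (fun S => ¬ crossesCut ep S f) : Finset (Finset V)) := by
        intro S hS T hT hST
        simp only [Finset.coe_filter, Set.mem_ofPred_eq, hiff] at hS hT
        ext x
        have key : ∀ y, y ≠ v → (y ∈ S ↔ y ∈ T) := by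
          intro y hy
          have := congrArg (fun Z : Finset V => y ∈ Z) hST
          simpa [hy] using this
        by_cases hx : x = v
        · rw [hx, ← hS.2, ← hT.2]
          exact key u hne
        · exact key x hx
      have hstep : ∑ S ∈ N.filter (fun S => ¬ crossesCut ep S f),
          Real.exp (-(24 * Real.log (M - 1) * cutWt ep w X S)) =
          ∑ S ∈ (N.filter (fun S => ¬ crossesCut ep S f)).image (fun S => S.erase v),
          Real.exp (-(24 * Real.log (M - 1) * cutWt (contr ep u v) w (X.erase v) S)) := by
        rw [Finset.sum_image hinj]
        apply Finset.sum_congr rfl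
        intro S hS
        rw [Finset.mem_filter, hiff] at hS
        rw [← contr_cut ep w X S u v hne h1 h2 hS.2]
        rw [cutWt_congr _ w _ S (S.erase v)]
        intro x hx
        rw [Finset.mem_erase] at hx
        simp [hx.1]
      rw [hstep]
      apply Finset.sum_le_sum_of_subset_of_nonneg
      · intro T hT
        rw [Finset.mem_image] at hT
        obtain ⟨S, hS, rfl⟩ := hT
        rw [Finset.mem_filter, hiff, hN, Finset.mem_filter, Finset.mem_powerset] at hS
        obtain ⟨⟨hSX, hSne, hSX'⟩, hSuv⟩ := hS
        rw [Finset.mem_filter, Finset.mem_powerset]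
        refine ⟨Finset.erase_subset_erase _ hSX, ?_, ?_⟩
        · obtain ⟨a, ha⟩ := hSne
          by_cases hav : a = v
          · exact ⟨u, by rw [Finset.mem_erase]; exact ⟨hne, hSuv.2 (hav ▸ ha)⟩⟩
          · exact ⟨a, by rw [Finset.mem_erase]; exact ⟨hav, ha⟩⟩
        · intro h
          apply hSX'
          apply Finset.Subset.antisymm hSX
          have key : ∀ y, y ≠ v → y ∈ X → y ∈ S := by
            intro y hy hyX
            have : y ∈ S.erase v := by rw [h, Finset.mem_erase]; exact ⟨hy, hyX⟩
            exact (Finset.mem_erase.1 this).2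
          intro x hx
          by_cases hxv : x = v
          · rw [hxv, ← hSuv]; exact key u hne h1
          · exact key x hxv hx
      · intros; exact (Real.exp_pos _).le
    have hsmall : ∑ S ∈ N.filter (fun S => cutWt ep w X S ≤ W / 2),
        Real.exp (-(24 * Real.log M * cutWt ep w X S)) ≤ 1 - 1 / (M - 1) := by
      have hWν : ∀ S, W - cutWt ep w X S = ∑ f : F,
          if (ep f).1 ∈ X ∧ (ep f).2 ∈ X ∧ (ep f).1 ≠ (ep f).2 then
            (if ¬ crossesCut ep S f then w f else 0) else 0 := by
        intro S
        rw [hW]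
        unfold cutWt
        rw [← Finset.sum_sub_distrib]
        apply Finset.sum_congr rfl
        intro f _
        by_cases a : (ep f).1 ∈ X <;> by_cases b : (ep f).2 ∈ X <;> simp [a, b]
        by_cases c : (ep f).1 = (ep f).2
        · have : ¬ crossesCut ep S f := by simp only [crossesCut, c]; tauto
          simp [c, this]
        · by_cases d : crossesCut ep S f <;> simp [c, d]
      have hb : ∀ S ∈ N.filter (fun S => cutWt ep w X S ≤ W / 2),
          Real.exp (-(24 * Real.log M * cutWt ep w X S)) ≤
          Real.exp (-(24 * Real.log (M - 1) * cutWt ep w X S)) * ((W - cutWt ep w X S) / W) := by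
        intro S hS
        rw [Finset.mem_filter] at hS
        exact exp_step M _ W hM2 (cutWt_nonneg ep w hw X S) hdeg hS.2
      refine (Finset.sum_le_sum hb).trans ?_
      have hb2 : ∀ S, Real.exp (-(24 * Real.log (M - 1) * cutWt ep w X S)) * ((W - cutWt ep w X S) / W)
          = (∑ f : F, if (ep f).1 ∈ X ∧ (ep f).2 ∈ X ∧ (ep f).1 ≠ (ep f).2 then
            w f * (if ¬ crossesCut ep S f then
              Real.exp (-(24 * Real.log (M - 1) * cutWt ep w X S)) else 0) else 0) / W := by
        intro S
        rw [← mul_div_assoc, hWν S, Finset.mul_sum]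
        congr 1
        apply Finset.sum_congr rfl
        intro f _
        split_ifs <;> ring
      rw [Finset.sum_congr rfl (fun S _ => hb2 S), ← Finset.sum_div, div_le_iff₀ hWpos,
        Finset.sum_comm, hW, Finset.mul_sum]
      apply Finset.sum_le_sum
      intro f _
      by_cases hf : (ep f).1 ∈ X ∧ (ep f).2 ∈ X ∧ (ep f).1 ≠ (ep f).2
      · simp only [if_pos hf]
        rw [← Finset.mul_sum, ← Finset.sum_filter, mul_comm]
        apply mul_le_mul_of_nonneg_right _ (hw f)
        refine le_trans ?_ (hcon f hf.1 hf.2.1 hf.2.2)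
        apply Finset.sum_le_sum_of_subset_of_nonneg
        · intro S hS
          simp only [Finset.mem_filter] at hS ⊢
          exact ⟨hS.1.1, hS.2⟩
        · intros; exact (Real.exp_pos _).le
      · simp [if_neg hf]
    have hbig : ∑ S ∈ N.filter (fun S => ¬ cutWt ep w X S ≤ W / 2),
        Real.exp (-(24 * Real.log M * cutWt ep w X S)) ≤ 1 / (M - 1) - 1 / M := by
      refine le_trans ?_ (big_step (m + 1 + 1) (by omega))
      have hlog : 0 ≤ Real.log M := Real.log_nonneg (by linarith)
      have : ∀ S ∈ N.filter (fun S => ¬ cutWt ep w X S ≤ W / 2),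
          Real.exp (-(24 * Real.log M * cutWt ep w X S)) ≤ Real.exp (-(24 * Real.log M * (M / 4))) := by
        intro S hS
        rw [Finset.mem_filter] at hS
        apply Real.exp_le_exp.2
        have : M / 4 ≤ cutWt ep w X S := by linarith [hS.2]
        have := mul_le_mul_of_nonneg_left this hlog
        linarith
      refine (Finset.sum_le_card_nsmul _ _ _ this).trans ?_
      rw [nsmul_eq_mul]
      apply mul_le_mul_of_nonneg_right _ (Real.exp_pos _).le
      have hc : (N.filter (fun S => ¬ cutWt ep w X S ≤ W / 2)).card ≤ 2 ^ (m + 1 + 1) := by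
        rw [← hX, ← Finset.card_powerset]
        apply Finset.card_le_card
        exact (Finset.filter_subset _ _).trans (Finset.filter_subset _ _)
      exact_mod_cast hc
    rw [← Finset.sum_filter_add_sum_filter_not N (fun S => cutWt ep w X S ≤ W / 2)]
    linarith

end counting

section layering

lemma exists_layers (K : Finset ℝ) : (∀ k ∈ K, 0 ≤ k) →
    ∃ c : ℝ → ℝ, (∀ k ∈ K, 0 ≤ c k) ∧ ∀ k ∈ K, ∑ j ∈ K, (if j ≤ k then c j else 0) = k := by
  induction K using Finset.induction_on_max with
  | empty => intro _; exact ⟨fun _ => 0, by simp, by simp⟩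
  | insert a s hlt ih =>
    intro hK
    obtain ⟨c, hc0, hc⟩ := ih (fun k hk => hK k (Finset.mem_insert_of_mem hk))
    have ha : a ∉ s := fun h => lt_irrefl _ (hlt a h)
    have hle : ∑ j ∈ s, c j ≤ a := by
      rcases s.eq_empty_or_nonempty with h | h
      · rw [h]; simpa using hK a (by simp)
      · have hm := s.max'_mem h
        have := hc _ hm
        have e : ∑ j ∈ s, (if j ≤ s.max' h then c j else 0) = ∑ j ∈ s, c j := by
          apply Finset.sum_congr rfl
          intro j hj
          rw [if_pos (s.le_max' j hj)]
        rw [e] at this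
        rw [this]
        exact (hlt _ hm).le
    refine ⟨Function.update c a (a - ∑ j ∈ s, c j), ?_, ?_⟩
    · intro k hk
      by_cases h : k = a
      · subst h; simp [hle]
      · rw [Function.update_of_ne h]
        exact hc0 k (by simpa [h] using hk)
    · have hs : ∀ k, ∑ j ∈ s, (if j ≤ k then Function.update c a (a - ∑ j ∈ s, c j) j else 0)
          = ∑ j ∈ s, (if j ≤ k then c j else 0) := by
        intro k
        apply Finset.sum_congr rfl
        intro j hj
        rw [Function.update_of_ne (by rintro rfl; exact ha hj)]
      intro k hk
      rw [Finset.sum_insert ha, hs]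
      rw [Finset.mem_insert] at hk
      rcases hk with rfl | hk
      · rw [if_pos le_rfl, Function.update_self]
        have e : ∑ j ∈ s, (if j ≤ k then c j else 0) = ∑ j ∈ s, c j := by
          apply Finset.sum_congr rfl
          intro j hj
          rw [if_pos (hlt j hj).le]
        rw [e]; ring
      · rw [if_neg (not_le.2 (hlt k hk)), hc k hk, zero_add]

lemma hCrosses_iff {V E : Type} (he : E → Finset V) (S : Finset V) (e : E) :
    hCrosses he S e ↔ (∃ a ∈ he e, a ∈ S) ∧ (∃ b ∈ he e, b ∉ S) := by
  simp [hCrosses, Finset.Nonempty]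

variable {V F : Type} [Fintype F] [Fintype V]

noncomputable def comps (ep : F → V × V) (w : F → ℝ) (k : ℝ) : Finset (Finset V) :=
  Finset.univ.image (comp ep w k)

lemma sum_comps (ep : F → V × V) (w : F → ℝ) (hw : ∀ f, 0 ≤ w f) (k : ℝ) (Z : Finset V) (z : V)
    (hz : z ∈ Z) (r : ℝ) :
    ∑ X ∈ comps ep w k, (if Z ⊆ X then r else 0) = if Z ⊆ comp ep w k z then r else 0 := by
  have key : ∀ X ∈ comps ep w k, Z ⊆ X → X = comp ep w k z := by
    intro X hX hZ
    simp only [comps, Finset.mem_image, Finset.mem_univ, true_and] at hX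
    obtain ⟨u, rfl⟩ := hX
    exact (comp_eq ep w hw k u z (hZ hz)).symm
  rw [Finset.sum_eq_single (comp ep w k z)]
  · intro X hX hne
    rw [if_neg]
    intro h
    exact hne (key X hX h)
  · intro h
    exact absurd (by simp [comps]) h

lemma layer {I : Type} [Fintype I] (ep : F → V × V) (w : F → ℝ) (hw : ∀ f, 0 ≤ w f)
    (K : Finset ℝ) (c : ℝ → ℝ)
    (hc : ∀ k ∈ K, ∑ j ∈ K, (if j ≤ k then c j else 0) = k)
    (Z : I → Finset V) (val : I → ℝ) (hZ : ∀ i, (Z i).Nonempty)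
    (hval : ∀ i, ∀ z ∈ Z i, ∀ k, Z i ⊆ comp ep w k z ↔ k ≤ val i)
    (hK : ∀ i, val i ∈ K) (hpos : ∀ i, 0 < val i) (g : I → ℝ) :
    ∑ k ∈ K, c k * ∑ X ∈ comps ep w k, ∑ i, (if Z i ⊆ X then g i / val i else 0) = ∑ i, g i := by
  have h1 : ∀ k, ∑ X ∈ comps ep w k, ∑ i, (if Z i ⊆ X then g i / val i else 0)
      = ∑ i, if k ≤ val i then g i / val i else 0 := by
    intro k
    rw [Finset.sum_comm]
    apply Finset.sum_congr rfl
    intro i _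
    obtain ⟨z, hz⟩ := hZ i
    rw [sum_comps ep w hw k (Z i) z hz]
    exact if_congr (hval i z hz k) rfl rfl
  simp only [h1, Finset.mul_sum]
  rw [Finset.sum_comm]
  apply Finset.sum_congr rfl
  intro i _
  have : ∀ k ∈ K, c k * (if k ≤ val i then g i / val i else 0)
      = (if k ≤ val i then c k else 0) * (g i / val i) := by
    intro k _
    split_ifs <;> ring
  rw [Finset.sum_congr rfl this, ← Finset.sum_mul, hc _ (hK i)]
  have := (hpos i).ne'
  field_simp

lemma det {E : Type} [Fintype E] (ep : F → V × V) (w : F → ℝ) (hw : ∀ f, 0 ≤ w f)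
    (hne : ∀ f, (ep f).1 ≠ (ep f).2)
    (he : E → Finset V) (own : F → E) (κ : E → ℝ) (hZ : ∀ e, (he e).Nonempty)
    (hκ : ∀ e, ∀ z ∈ he e, ∀ k, he e ⊆ comp ep w k z ↔ k ≤ κ e)
    (hκpos : ∀ e, 0 < κ e) (hfpos : ∀ f, 0 < strength ep w f)
    (hown : ∀ f, (ep f).1 ∈ he (own f) ∧ (ep f).2 ∈ he (own f))
    (hsum : ∀ e, (∑ f, if own f = e then w f else 0) = 1)
    (K : Finset ℝ) (hK0 : ∀ k ∈ K, 0 < k) (hKe : ∀ e, κ e ∈ K) (hKf : ∀ f, strength ep w f ∈ K)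
    (y : E → ℝ) (ε : ℝ) (hε : 0 ≤ ε)
    (hgood : ∀ k ∈ K, ∀ u, ∀ S : Finset V, S ⊆ comp ep w k u → S.Nonempty → S ≠ comp ep w k u →
      |∑ e, if he e ⊆ comp ep w k u ∧ hCrosses he S e then y e / κ e else 0| ≤
        ε * ((∑ e, if he e ⊆ comp ep w k u ∧ hCrosses he S e then 1 / κ e else 0) +
          cutWt ep (fun f => w f / strength ep w f) (comp ep w k u) S)) (S : Finset V) :
    |∑ e, if hCrosses he S e then y e else 0| ≤
      2 * ε * ∑ e, (if hCrosses he S e then (1 : ℝ) else 0) := by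
  obtain ⟨c, hc0, hc⟩ := exists_layers K (fun k hk => (hK0 k hk).le)
  have hν0 : ∀ f, 0 ≤ w f / strength ep w f := fun f => div_nonneg (hw f) (hfpos f).le
  have hgood' : ∀ k ∈ K, ∀ X ∈ comps ep w k,
      |∑ e, if he e ⊆ X ∧ hCrosses he S e then y e / κ e else 0| ≤
        ε * ((∑ e, if he e ⊆ X ∧ hCrosses he S e then 1 / κ e else 0) +
          cutWt ep (fun f => w f / strength ep w f) X S) := by
    intro k hk X hX
    simp only [comps, Finset.mem_image, Finset.mem_univ, true_and] at hX
    obtain ⟨u, hu⟩ := hX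
    by_cases htriv : (∃ a ∈ X, a ∈ S) ∧ (∃ b ∈ X, b ∉ S)
    · obtain ⟨⟨a, haX, haS⟩, ⟨b, hbX, hbS⟩⟩ := htriv
      have := hgood k hk u (X.filter (· ∈ S)) (by rw [hu]; exact Finset.filter_subset _ _)
        ⟨a, by simp [haX, haS]⟩ (by
          rw [hu]
          intro h
          rw [← h] at hbX
          simp at hbX
          exact hbS hbX.2)
      rw [hu] at this
      have hiff : ∀ e, (he e ⊆ X ∧ hCrosses he (X.filter (· ∈ S)) e) ↔
          (he e ⊆ X ∧ hCrosses he S e) := by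
        intro e
        apply and_congr_right
        intro hsub
        rw [hCrosses_iff, hCrosses_iff]
        apply and_congr
        · constructor
          · rintro ⟨a, h1, h2⟩; exact ⟨a, h1, (Finset.mem_filter.1 h2).2⟩
          · rintro ⟨a, h1, h2⟩; exact ⟨a, h1, Finset.mem_filter.2 ⟨hsub h1, h2⟩⟩
        · constructor
          · rintro ⟨a, h1, h2⟩; exact ⟨a, h1, fun h => h2 (Finset.mem_filter.2 ⟨hsub h1, h⟩)⟩
          · rintro ⟨a, h1, h2⟩; exact ⟨a, h1, fun h => h2 (Finset.mem_filter.1 h).2⟩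
      rw [cutWt_congr ep _ X S (X.filter (· ∈ S)) (by intro x hx; simp [hx])]
      have e1 : ∀ g : E → ℝ, (∑ e, if he e ⊆ X ∧ hCrosses he S e then g e else 0) =
          ∑ e, if he e ⊆ X ∧ hCrosses he (X.filter (· ∈ S)) e then g e else 0 := by
        intro g
        apply Finset.sum_congr rfl
        intro e _
        exact if_congr (hiff e).symm rfl rfl
      rw [e1, e1]
      exact this
    · have : ∀ e, ¬ (he e ⊆ X ∧ hCrosses he S e) := by
        rintro e ⟨h1, h2⟩
        rw [hCrosses_iff] at h2
        obtain ⟨⟨a, ha, ha'⟩, ⟨b, hb, hb'⟩⟩ := h2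
        exact htriv ⟨⟨a, h1 ha, ha'⟩, ⟨b, h1 hb, hb'⟩⟩
      simp only [if_neg (this _), Finset.sum_const_zero, abs_zero, zero_add]
      exact mul_nonneg hε (cutWt_nonneg ep _ hν0 X S)
  have L := layer ep w hw K c hc he κ hZ hκ hKe hκpos
  have LF := layer ep w hw K c hc (fun f => {(ep f).1, (ep f).2}) (strength ep w)
    (fun f => ⟨(ep f).1, by simp⟩) (by
      intro f z hz k
      have hsub : ∀ u, ({(ep f).1, (ep f).2} : Finset V) ⊆ u ↔ (ep f).1 ∈ u ∧ (ep f).2 ∈ u := by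
        intro u; rw [Finset.insert_subset_iff, Finset.singleton_subset_iff]
      rw [hsub, ← mem_comp_iff ep w hw k f (hne f)]
      simp only [Finset.mem_insert, Finset.mem_singleton] at hz
      constructor
      · rintro ⟨h1, h2⟩
        have := comp_eq ep w hw k z _ h1
        rw [this]; exact h2
      · intro h
        have h' : z ∈ comp ep w k (ep f).1 := by
          rcases hz with rfl | rfl
          · exact self_mem_comp ep w k _
          · exact h
        rw [comp_eq ep w hw k _ _ h']
        exact ⟨self_mem_comp ep w k _, h⟩) hKf hfpos
  have conv : ∀ (g : E → ℝ) (X : Finset V), (∑ e, if he e ⊆ X ∧ hCrosses he S e then g e / κ e else 0)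
      = ∑ e, if he e ⊆ X then (if hCrosses he S e then g e else 0) / κ e else 0 := by
    intro g X
    apply Finset.sum_congr rfl
    intro e _
    by_cases h1 : he e ⊆ X <;> by_cases h2 : hCrosses he S e <;> simp [h1, h2]
  have convF : ∀ X : Finset V, cutWt ep (fun f => w f / strength ep w f) X S =
      ∑ f, if ({(ep f).1, (ep f).2} : Finset V) ⊆ X then
        (if crossesCut ep S f then w f else 0) / strength ep w f else 0 := by
    intro X
    unfold cutWt
    apply Finset.sum_congr rfl
    intro f _
    have hsub : ({(ep f).1, (ep f).2} : Finset V) ⊆ X ↔ (ep f).1 ∈ X ∧ (ep f).2 ∈ X := by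
      rw [Finset.insert_subset_iff, Finset.singleton_subset_iff]
    by_cases h1 : (ep f).1 ∈ X <;> by_cases h3 : (ep f).2 ∈ X <;>
      by_cases h2 : crossesCut ep S f <;> simp [hsub, h1, h2, h3]
  have hF : (∑ f, if crossesCut ep S f then w f else 0) ≤
      ∑ e, (if hCrosses he S e then (1 : ℝ) else 0) := by
    have h1 : ∀ e, (if hCrosses he S e then (1 : ℝ) else 0) =
        ∑ f, if own f = e then (if hCrosses he S (own f) then w f else 0) else 0 := by
      intro e
      split_ifs with h
      · rw [← hsum e]
        apply Finset.sum_congr rfl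
        intro f _
        split_ifs with h2 h3
        · rfl
        · rw [h2] at h3; exact absurd h h3
        · rfl
      · symm
        apply Finset.sum_eq_zero
        intro f _
        split_ifs with h2 h3
        · rw [h2] at h3; exact absurd h3 h
        · rfl
        · rfl
    rw [Finset.sum_congr rfl (fun e _ => h1 e), Finset.sum_comm]
    apply Finset.sum_le_sum
    intro f _
    rw [Finset.sum_ite_eq, if_pos (Finset.mem_univ _)]
    by_cases hc : crossesCut ep S f
    · have : hCrosses he S (own f) := by
        rw [hCrosses_iff]
        rcases hc with h | h
        · exact ⟨⟨_, (hown f).1, h.1⟩, ⟨_, (hown f).2, h.2⟩⟩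
        · exact ⟨⟨_, (hown f).2, h.2⟩, ⟨_, (hown f).1, h.1⟩⟩
      rw [if_pos hc, if_pos this]
    · rw [if_neg hc]
      split_ifs
      · exact hw f
      · exact le_rfl
  calc |∑ e, if hCrosses he S e then y e else 0|
      = |∑ k ∈ K, c k * ∑ X ∈ comps ep w k,
          ∑ e, if he e ⊆ X ∧ hCrosses he S e then y e / κ e else 0| := by
        rw [← L]
        simp only [conv]
    _ ≤ ∑ k ∈ K, c k * ∑ X ∈ comps ep w k,
          (ε * ((∑ e, if he e ⊆ X ∧ hCrosses he S e then 1 / κ e else 0) +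
          cutWt ep (fun f => w f / strength ep w f) X S)) := by
        refine (Finset.abs_sum_le_sum_abs _ _).trans ?_
        apply Finset.sum_le_sum
        intro k hk
        rw [abs_mul, abs_of_nonneg (hc0 k hk)]
        apply mul_le_mul_of_nonneg_left _ (hc0 k hk)
        refine (Finset.abs_sum_le_sum_abs _ _).trans ?_
        exact Finset.sum_le_sum (fun X hX => hgood' k hk X hX)
    _ = ε * ((∑ e, (if hCrosses he S e then (1 : ℝ) else 0)) +
          ∑ f, if crossesCut ep S f then w f else 0) := by
        rw [← L, ← LF]
        simp only [convF, conv]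
        rw [← Finset.sum_add_distrib, Finset.mul_sum]
        apply Finset.sum_congr rfl
        intro k _
        rw [← Finset.mul_sum, Finset.sum_add_distrib]
        ring
    _ ≤ _ := by nlinarith

end layering

section prob

variable {E : Type} [Fintype E] [DecidableEq E]

lemma prodE (p a b : E → ℝ) :
    ∑ A : Finset E, sampleProb p A * ((∏ e ∈ A, a e) * ∏ e ∈ Aᶜ, b e) =
      ∏ e, (p e * a e + (1 - p e) * b e) := by
  rw [Finset.prod_add, Finset.powerset_univ]
  apply Finset.sum_congr rfl
  intro A _
  rw [Finset.prod_mul_distrib, ← Finset.compl_eq_univ_sdiff, Finset.prod_mul_distrib]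
  unfold sampleProb
  ring

lemma prodE' (p : E → ℝ) (h : E → Prop → ℝ) :
    ∑ A : Finset E, sampleProb p A * ∏ e, h e (e ∈ A) =
      ∏ e, (p e * h e True + (1 - p e) * h e False) := by
  rw [← prodE]
  apply Finset.sum_congr rfl
  intro A _
  rw [← Finset.prod_mul_prod_compl A]
  congr 2
  · apply Finset.prod_congr rfl
    intro e he
    simp [he]
  · apply Finset.prod_congr rfl
    intro e he
    rw [Finset.mem_compl] at he
    simp [he]

lemma sampleProb_sum (p : E → ℝ) : ∑ A : Finset E, sampleProb p A = 1 := by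
  have := prodE' p (fun _ _ => 1)
  simpa using this

lemma sampleProb_nonneg (p : E → ℝ) (h0 : ∀ e, 0 ≤ p e) (h1 : ∀ e, p e ≤ 1) (A : Finset E) :
    0 ≤ sampleProb p A := by
  unfold sampleProb
  apply mul_nonneg
  · exact Finset.prod_nonneg (fun e _ => h0 e)
  · exact Finset.prod_nonneg (fun e _ => by linarith [h1 e])

lemma sampleProb_card (p : E → ℝ) :
    ∑ A : Finset E, sampleProb p A * (A.card : ℝ) = ∑ e, p e := by
  have h : ∀ e, ∑ A : Finset E, sampleProb p A * (if e ∈ A then 1 else 0) = p e := by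
    intro e
    have := prodE' p (fun e' P => if e' = e then (if P then 1 else 0) else 1)
    simp only [Finset.prod_ite_eq', Finset.mem_univ, if_true] at this
    refine Eq.trans (Finset.sum_congr rfl (fun A _ => by congr)) (this.trans ?_)
    rw [Finset.prod_eq_single e]
    · simp
    · intro b _ hb
      simp [hb]
    · simp
  rw [← Finset.sum_congr rfl (fun e _ => h e), Finset.sum_comm]
  apply Finset.sum_congr rfl
  intro A _
  rw [← Finset.mul_sum]
  simp

lemma factor_le (ρ κ p σ : ℝ) (hρ : 0 < ρ) (hκ : 0 < κ) (hp : p = min 1 (ρ / κ)) (hσ : |σ| ≤ 1) :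
    p * Real.exp (σ * ρ * ((1 / p - 1) / κ)) + (1 - p) * Real.exp (σ * ρ * ((0 - 1) / κ)) ≤
      Real.exp (σ ^ 2 * ρ * (1 / κ)) := by
  rcases le_total 1 (ρ / κ) with h | h
  · rw [min_eq_left h] at hp
    subst hp
    simp only [div_one, sub_self, zero_div, mul_zero, Real.exp_zero, mul_one, zero_mul, add_zero]
    apply Real.one_le_exp
    positivity
  · rw [min_eq_right h] at hp
    have hp0 : 0 < p := by rw [hp]; positivity
    have e1 : σ * ρ * ((1 / p - 1) / κ) = σ + -(σ * p) := by
      rw [hp]; field_simp; ring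
    have e2 : σ * ρ * ((0 - 1) / κ) = -(σ * p) := by
      rw [hp]; field_simp; ring
    have e3 : σ ^ 2 * ρ * (1 / κ) = p * σ ^ 2 := by
      rw [hp]; field_simp
    rw [e1, e2, e3, Real.exp_add]
    have h1 : p * (Real.exp σ - 1) + 1 ≤ Real.exp (p * (Real.exp σ - 1)) := Real.add_one_le_exp _
    have h2 : Real.exp σ - 1 - σ ≤ σ ^ 2 := (le_abs_self _).trans (Real.abs_exp_sub_one_sub_id_le hσ)
    calc p * (Real.exp σ * Real.exp (-(σ * p))) + (1 - p) * Real.exp (-(σ * p))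
        = (p * (Real.exp σ - 1) + 1) * Real.exp (-(σ * p)) := by ring
      _ ≤ Real.exp (p * (Real.exp σ - 1)) * Real.exp (-(σ * p)) :=
          mul_le_mul_of_nonneg_right h1 (Real.exp_pos _).le
      _ = Real.exp (p * (Real.exp σ - 1 - σ)) := by rw [← Real.exp_add]; ring_nf
      _ ≤ _ := Real.exp_le_exp.2 (mul_le_mul_of_nonneg_left h2 hp0.le)

/-- The centred, scaled deviation. -/
noncomputable def dev (p κ : E → ℝ) (B : E → Prop) (A : Finset E) : ℝ :=
  ∑ e, if B e then ((if e ∈ A then 1 / p e else 0) - 1) / κ e else 0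

lemma mgf (p κ : E → ℝ) (ρ : ℝ) (hρ : 0 < ρ) (hκ : ∀ e, 0 < κ e)
    (hp : ∀ e, p e = min 1 (ρ / κ e)) (B : E → Prop) (σ : ℝ) (hσ : |σ| ≤ 1) :
    ∑ A : Finset E, sampleProb p A * Real.exp (σ * ρ * dev p κ B A) ≤
      Real.exp (σ ^ 2 * ρ * ∑ e, if B e then 1 / κ e else 0) := by
  have h0 : ∀ e, 0 ≤ p e := fun e => by
    rw [hp]; exact le_min zero_le_one (div_nonneg hρ.le (hκ e).le)
  have h1 : ∀ e, p e ≤ 1 := fun e => by rw [hp]; exact min_le_left _ _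
  have := prodE' p (fun e P => if B e then
    Real.exp (σ * ρ * (((if P then 1 / p e else 0) - 1) / κ e)) else 1)
  have e1 : ∀ A : Finset E, Real.exp (σ * ρ * dev p κ B A) = ∏ e, if B e then
    Real.exp (σ * ρ * (((if e ∈ A then 1 / p e else 0) - 1) / κ e)) else 1 := by
    intro A
    unfold dev
    rw [Finset.mul_sum, Real.exp_sum]
    apply Finset.prod_congr rfl
    intro e _
    by_cases hB : B e <;> simp [hB]
  rw [Finset.sum_congr rfl (fun A _ => by rw [e1 A])]
  convert this.trans_le ?_ using 4
  · congr!
  rw [Finset.mul_sum, Real.exp_sum]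
  apply Finset.prod_le_prod
  · intro e _
    have := h0 e
    have := h1 e
    split_ifs
    all_goals
      have := sub_nonneg.2 (h1 e)
      positivity
  · intro e _
    by_cases hB : B e
    · simp only [hB, if_true, if_false]
      exact factor_le ρ (κ e) (p e) σ hρ (hκ e) (hp e) hσ
    · simp [hB]

lemma chernoff (p κ : E → ℝ) (ρ : ℝ) (hρ : 0 < ρ) (hκ : ∀ e, 0 < κ e)
    (hp : ∀ e, p e = min 1 (ρ / κ e)) (B : E → Prop) (ε M : ℝ) (hε0 : 0 < ε) (hε1 : ε ≤ 1)
    (hM : (∑ e, if B e then 1 / κ e else 0) ≤ M) :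
    ∑ A : Finset E, (if |dev p κ B A| ≤ ε * M then 0 else sampleProb p A) ≤
      2 * Real.exp (-(ρ * ε ^ 2 / 4 * M)) := by
  have h0 : ∀ e, 0 ≤ p e := fun e => by
    rw [hp]; exact le_min zero_le_one (div_nonneg hρ.le (hκ e).le)
  have h1 : ∀ e, p e ≤ 1 := fun e => by rw [hp]; exact min_le_left _ _
  have key : ∀ σ : ℝ, σ ^ 2 = (ε / 2) ^ 2 → |σ| ≤ 1 →
      ∑ A : Finset E, sampleProb p A * Real.exp (σ * ρ * dev p κ B A - ε ^ 2 / 2 * ρ * M) ≤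
      Real.exp (-(ρ * ε ^ 2 / 4 * M)) := by
    intro σ hσ hσ1
    have := mgf p κ ρ hρ hκ hp B σ hσ1
    simp only [Real.exp_sub, ← mul_div_assoc]
    rw [← Finset.sum_div, div_le_iff₀ (Real.exp_pos _), ← Real.exp_add]
    refine this.trans (Real.exp_le_exp.2 ?_)
    rw [hσ]
    have := mul_le_mul_of_nonneg_left hM (show 0 ≤ (ε / 2) ^ 2 * ρ by positivity)
    nlinarith
  have k1 := key (ε / 2) rfl (by rw [abs_of_pos (by linarith)]; linarith)
  have k2 := key (-(ε / 2)) (by ring) (by rw [abs_neg, abs_of_pos (by linarith)]; linarith)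
  rw [two_mul]
  refine le_trans ?_ (add_le_add k1 k2)
  rw [← Finset.sum_add_distrib]
  apply Finset.sum_le_sum
  intro A _
  have hs := sampleProb_nonneg p h0 h1 A
  split_ifs with h
  · positivity
  · rw [← mul_add]
    apply le_mul_of_one_le_right hs
    rw [not_le, lt_abs] at h
    rcases h with h | h
    · have : 1 ≤ Real.exp (ε / 2 * ρ * dev p κ B A - ε ^ 2 / 2 * ρ * M) := by
        apply Real.one_le_exp
        have := mul_le_mul_of_nonneg_left h.le (show 0 ≤ ε / 2 * ρ by positivity)
        nlinarith
      linarith [Real.exp_pos (-(ε / 2) * ρ * dev p κ B A - ε ^ 2 / 2 * ρ * M)]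
    · have : 1 ≤ Real.exp (-(ε / 2) * ρ * dev p κ B A - ε ^ 2 / 2 * ρ * M) := by
        apply Real.one_le_exp
        have := mul_le_mul_of_nonneg_left h.le (show 0 ≤ ε / 2 * ρ by positivity)
        nlinarith
      linarith [Real.exp_pos (ε / 2 * ρ * dev p κ B A - ε ^ 2 / 2 * ρ * M)]

end prob

section assembly

lemma weight_le_strength {V F : Type} [Fintype V] [Fintype F] (ep : F → V × V) (w : F → ℝ)
    (hw : ∀ f, 0 ≤ w f) (f : F) (hne : (ep f).1 ≠ (ep f).2) : w f ≤ strength ep w f := by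
  apply le_strength ep w (w f) {(ep f).1, (ep f).2} f _ (by simp) (by simp) hne
  rintro S ⟨a, ha, ha'⟩ ⟨b, hb, hb'⟩
  unfold cutWt
  have hcr : crossesCut ep S f := by
    simp only [Finset.mem_insert, Finset.mem_singleton] at ha hb
    rcases ha with rfl | rfl <;> rcases hb with rfl | rfl
    · exact absurd ha' hb'
    · exact Or.inl ⟨ha', hb'⟩
    · exact Or.inr ⟨hb', ha'⟩
    · exact absurd ha' hb'
  have := Finset.single_le_sum (f := fun g => if (ep g).1 ∈ ({(ep f).1, (ep f).2} : Finset V) ∧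
    (ep g).2 ∈ ({(ep f).1, (ep f).2} : Finset V) ∧ crossesCut ep S g then w g else 0)
    (fun g _ => by
      split_ifs
      · exact hw g
      · exact le_rfl) (Finset.mem_univ f)
  refine le_trans ?_ this
  rw [if_pos ⟨by simp, by simp, hcr⟩]

noncomputable def pairStrength {V F : Type} [Fintype F] (ep : F → V × V) (w : F → ℝ)
    (q : V × V) : ℝ :=
  sSup {c : ℝ | ∃ X : Finset V, q.1 ∈ X ∧ q.2 ∈ X ∧ c = minCutIn ep w X}

/-- The hyperedge lies inside `X` and crosses `S`. -/
def inB {V E : Type} (he : E → Finset V) (X S : Finset V) (e : E) : Prop :=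
  he e ⊆ X ∧ hCrosses he S e

lemma main_abs {V F E : Type} [Fintype V] [Fintype F] [Fintype E] [DecidableEq E]
    (ep : F → V × V) (w : F → ℝ) (hw : ∀ f, 0 ≤ w f)
    (hne : ∀ f, (ep f).1 ≠ (ep f).2)
    (he : E → Finset V) (own : F → E) (κ : E → ℝ) (hZ : ∀ e, (he e).Nonempty)
    (hκ : ∀ e, ∀ z ∈ he e, ∀ k, he e ⊆ comp ep w k z ↔ k ≤ κ e)
    (hκpos : ∀ e, 0 < κ e) (hfpos : ∀ f, 0 < strength ep w f)
    (hown : ∀ f, (ep f).1 ∈ he (own f) ∧ (ep f).2 ∈ he (own f))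
    (hsum : ∀ e, (∑ f, if own f = e then w f else 0) = 1)
    (hκmem : ∀ e, ∃ f, κ e = strength ep w f)
    (hV : 2 ≤ Fintype.card V) (ε ρ : ℝ) (hε0 : 0 < ε) (hε1 : ε ≤ 1) (hρ : 0 < ρ) (d : ℕ)
    (hρ4 : 5 * ((d : ℝ) + 6) * Real.log (Fintype.card V) ≤ ρ * ε ^ 2 / 4)
    (p : E → ℝ) (hp : ∀ e, p e = min 1 (ρ / κ e)) :
    ∑ A : Finset E, (if ∀ S : Finset V,
      |∑ e, if hCrosses he S e then ((if e ∈ A then 1 / p e else 0) - 1) else 0| ≤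
        2 * ε * ∑ e, (if hCrosses he S e then (1 : ℝ) else 0) then 0 else sampleProb p A)
      ≤ 4 / (Fintype.card V : ℝ) ^ d := by
  have h0 : ∀ e, 0 ≤ p e := fun e => by
    rw [hp]; exact le_min zero_le_one (div_nonneg hρ.le (hκpos e).le)
  have h1 : ∀ e, p e ≤ 1 := fun e => by rw [hp]; exact min_le_left _ _
  set n := Fintype.card V with hn
  have hn2 : (2 : ℝ) ≤ n := by exact_mod_cast hV
  set L := Real.log n with hL
  have hL0 : 0 < L := Real.log_pos (by linarith)
  set K : Finset ℝ := ((Finset.univ : Finset (V × V)).image (pairStrength ep w)).filter (0 < ·)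
    with hK
  have hK0 : ∀ k ∈ K, 0 < k := fun k hk => (Finset.mem_filter.1 hk).2
  have hKf : ∀ f, strength ep w f ∈ K := by
    intro f
    rw [hK, Finset.mem_filter, Finset.mem_image]
    exact ⟨⟨ep f, Finset.mem_univ _, rfl⟩, hfpos f⟩
  have hKe : ∀ e, κ e ∈ K := by
    intro e
    obtain ⟨f, hf⟩ := hκmem e
    rw [hf]; exact hKf f
  have hKcard : (K.card : ℝ) ≤ (n : ℝ) ^ 2 := by
    have : K.card ≤ n ^ 2 := by
      refine (Finset.card_filter_le _ _).trans (Finset.card_image_le.trans ?_)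
      rw [Finset.card_univ, Fintype.card_prod, sq]
    exact_mod_cast this
  set N : Finset V → Finset (Finset V) :=
    fun X => X.powerset.filter (fun S => S.Nonempty ∧ S ≠ X) with hN
  set ν : Finset V → Finset V → ℝ :=
    fun X S => cutWt ep (fun f => w f / strength ep w f) X S with hν
  set M : Finset V → Finset V → ℝ := fun X S => (∑ e, if inB he X S e then 1 / κ e else 0) + ν X S with hM
  have hν0 : ∀ f, 0 ≤ w f / strength ep w f := fun f => div_nonneg (hw f) (hfpos f).le
  -- union bound
  have hunion : ∀ A : Finset E, (if ∀ S : Finset V,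
      |∑ e, if hCrosses he S e then ((if e ∈ A then 1 / p e else 0) - 1) else 0| ≤
        2 * ε * ∑ e, (if hCrosses he S e then (1 : ℝ) else 0) then 0 else sampleProb p A) ≤
      ∑ k ∈ K, ∑ u : V, ∑ S ∈ N (comp ep w k u),
        (if |dev p κ (inB he (comp ep w k u) S) A| ≤ ε * M (comp ep w k u) S then 0 else sampleProb p A) := by
    intro A
    have hs := sampleProb_nonneg p h0 h1 A
    have hnn : ∀ k u S, 0 ≤ (if |dev p κ (inB he (comp ep w k u) S) A| ≤ ε * M (comp ep w k u) S
        then 0 else sampleProb p A) := by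
      intro k u S
      split_ifs
      · exact le_rfl
      · exact hs
    by_cases hall : ∀ k ∈ K, ∀ u, ∀ S ∈ N (comp ep w k u),
        |dev p κ (inB he (comp ep w k u) S) A| ≤ ε * M (comp ep w k u) S
    · rw [if_pos]
      · exact Finset.sum_nonneg (fun k _ => Finset.sum_nonneg (fun u _ =>
          Finset.sum_nonneg (fun S _ => hnn k u S)))
      · intro S
        have := det ep w hw hne he own κ hZ hκ hκpos hfpos hown (fun e => by convert hsum e) K hK0 hKe hKf
          (fun e => (if e ∈ A then 1 / p e else 0) - 1) ε hε0.le (by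
            intro k hk u S h1 h2 h3
            have h := hall k hk u S (by
              simp only [hN, Finset.mem_filter, Finset.mem_powerset]
              exact ⟨h1, h2, h3⟩)
            simp only [dev, hM, hν] at h
            convert h <;> exact Iff.rfl) S
        exact this
    · push Not at hall
      obtain ⟨k, hk, u, S, hS, hbad⟩ := hall
      have e1 : sampleProb p A ≤ (if |dev p κ (inB he (comp ep w k u) S) A| ≤ ε * M (comp ep w k u) S
        then 0 else sampleProb p A) := by rw [if_neg (not_le.2 hbad)]
      have e2 := Finset.single_le_sum (f := fun S => (if |dev p κ (inB he (comp ep w k u) S) A| ≤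
        ε * M (comp ep w k u) S then 0 else sampleProb p A)) (fun S _ => hnn k u S) hS
      have e3 := Finset.single_le_sum (f := fun u => ∑ S ∈ N (comp ep w k u),
        (if |dev p κ (inB he (comp ep w k u) S) A| ≤
        ε * M (comp ep w k u) S then 0 else sampleProb p A))
        (fun u _ => Finset.sum_nonneg (fun S _ => hnn k u S)) (Finset.mem_univ u)
      have e4 := Finset.single_le_sum (f := fun k => ∑ u : V, ∑ S ∈ N (comp ep w k u),
        (if |dev p κ (inB he (comp ep w k u) S) A| ≤
        ε * M (comp ep w k u) S then 0 else sampleProb p A))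
        (fun k _ => Finset.sum_nonneg (fun u _ => Finset.sum_nonneg (fun S _ => hnn k u S))) hk
      refine le_trans ?_ (e1.trans (e2.trans (e3.trans e4)))
      split_ifs
      · exact hs
      · exact le_rfl
  have hku : ∀ k ∈ K, ∀ u, ∑ S ∈ N (comp ep w k u), ∑ A : Finset E,
        (if |dev p κ (inB he (comp ep w k u) S) A| ≤ ε * M (comp ep w k u) S then 0 else sampleProb p A)
        ≤ 2 * Real.exp (-((5 * d + 6) * L)) := by
    intro k hk u
    set X := comp ep w k u with hX
    have hstr := nu_ge_one ep w hw hne k (hK0 k hk) u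
    rw [← hX] at hstr
    have hXpos : 0 < X.card := Finset.card_pos.2 ⟨u, self_mem_comp ep w k u⟩
    have hXn : X.card ≤ n := Finset.card_le_univ X
    have hlog : Real.log (X.card : ℝ) ≤ L :=
      Real.log_le_log (by exact_mod_cast hXpos) (by exact_mod_cast hXn)
    have hcount := count_cuts (X.card - 1) X ep (fun f => w f / strength ep w f)
      (by omega) hν0 hstr
    have hc1 : X.card - 1 + 1 = X.card := by omega
    rw [hc1] at hcount
    have hterm : ∀ S ∈ N X, ∑ A : Finset E,
        (if |dev p κ (inB he X S) A| ≤ ε * M X S then 0 else sampleProb p A) ≤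
        2 * Real.exp (-((5 * d + 6) * L)) * Real.exp (-(24 * Real.log (X.card : ℝ) * ν X S)) := by
      intro S hS
      simp only [hN, Finset.mem_filter, Finset.mem_powerset] at hS
      obtain ⟨hSX, ⟨a, ha⟩, hSneX⟩ := hS
      have hν1 : 1 ≤ ν X S := by
        apply hstr S ⟨a, hSX ha, ha⟩
        by_contra hcon
        push Not at hcon
        exact hSneX (Finset.Subset.antisymm hSX hcon)
      have hμ : 0 ≤ ∑ e, if inB he X S e then 1 / κ e else 0 := by
        apply Finset.sum_nonneg
        intro e _
        have := hκpos e
        split_ifs <;> positivity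
      refine (chernoff p κ ρ hρ hκpos hp (inB he X S) ε (M X S) hε0 hε1
        (by simp only [hM]; linarith)).trans ?_
      rw [mul_assoc, ← Real.exp_add]
      apply mul_le_mul_of_nonneg_left _ (by norm_num)
      apply Real.exp_le_exp.2
      have g1 : 24 * Real.log (X.card : ℝ) * ν X S ≤ 24 * L * ν X S := by
        apply mul_le_mul_of_nonneg_right _ (by linarith)
        linarith
      have hd0 : (0 : ℝ) ≤ d := Nat.cast_nonneg d
      have g2 : (5 * (d : ℝ) + 6) * L ≤ (5 * d + 6) * L * ν X S := by
        apply le_mul_of_one_le_right _ hν1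
        positivity
      have g3 : 5 * ((d : ℝ) + 6) * L * ν X S ≤ ρ * ε ^ 2 / 4 * ν X S :=
        mul_le_mul_of_nonneg_right hρ4 (by linarith)
      have g4 : ρ * ε ^ 2 / 4 * ν X S ≤ ρ * ε ^ 2 / 4 * M X S := by
        apply mul_le_mul_of_nonneg_left _ (by positivity)
        simp only [hM]; linarith
      linarith
    refine (Finset.sum_le_sum hterm).trans ?_
    rw [← Finset.mul_sum]
    apply mul_le_of_le_one_right (by positivity)
    refine hcount.trans ?_
    have : (0 : ℝ) ≤ 1 / (X.card : ℝ) := by positivity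
    linarith
  refine (Finset.sum_le_sum (fun A _ => hunion A)).trans ?_
  rw [Finset.sum_comm]
  have hk : ∀ k ∈ K, ∑ A : Finset E, ∑ u : V, ∑ S ∈ N (comp ep w k u),
        (if |dev p κ (inB he (comp ep w k u) S) A| ≤ ε * M (comp ep w k u) S then 0 else sampleProb p A)
        ≤ n * (2 * Real.exp (-((5 * d + 6) * L))) := by
    intro k hk
    rw [Finset.sum_comm]
    have : ∀ u ∈ (Finset.univ : Finset V), ∑ A : Finset E, ∑ S ∈ N (comp ep w k u),
        (if |dev p κ (inB he (comp ep w k u) S) A| ≤ ε * M (comp ep w k u) S then 0 else sampleProb p A)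
        ≤ 2 * Real.exp (-((5 * d + 6) * L)) := by
      intro u _
      rw [Finset.sum_comm]
      exact hku k hk u
    refine (Finset.sum_le_card_nsmul _ _ _ this).trans ?_
    rw [nsmul_eq_mul, Finset.card_univ]
  refine (Finset.sum_le_card_nsmul _ _ _ hk).trans ?_
  rw [nsmul_eq_mul]
  have hexp : Real.exp (-((5 * d + 6) * L)) = 1 / (n : ℝ) ^ (5 * d + 6) := by
    rw [Real.exp_neg, mul_comm, Real.exp_mul, hL, Real.exp_log (by linarith), one_div]
    congr 1
    rw [← Real.rpow_natCast]
    push_cast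
    rfl
  rw [hexp]
  have hn1 : (1 : ℝ) ≤ n := by linarith
  have hn0 : (0 : ℝ) < n := by linarith
  calc (K.card : ℝ) * (n * (2 * (1 / (n : ℝ) ^ (5 * d + 6))))
      ≤ (n : ℝ) ^ 2 * (n * (2 * (1 / (n : ℝ) ^ (5 * d + 6)))) :=
        mul_le_mul_of_nonneg_right hKcard (by positivity)
    _ = 2 / (n : ℝ) ^ (5 * d + 3) := by
        have : (n : ℝ) ^ (5 * d + 6) = (n : ℝ) ^ (5 * d + 3) * (n : ℝ) ^ 3 := by
          rw [← pow_add]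
        rw [this]
        field_simp
    _ ≤ 2 / (n : ℝ) ^ d := by
        apply div_le_div_of_nonneg_left (by norm_num) (by positivity)
        exact pow_le_pow_right₀ hn1 (by omega)
    _ ≤ 4 / (n : ℝ) ^ d := by
        apply div_le_div_of_nonneg_right (by norm_num) (by positivity)

end assembly

/-- Sampling each hyperedge `e` independently with probability
`p_e = min(1, ρ/κ_e)`, `ρ = 8(d+6)γ²·log n/(0.38 ε²)`, and weighting sampled edges by `1/p_e`,
yields with probability at least `1 − 4n^{−d}` a weighted subhypergraph approximating every cut
within a factor `(1 ± 2ε)`; moreover the expected number of sampled hyperedges is at most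
`ρ·γ·(n − 1)`. -/
theorem stmt9 {V E : Type} [Fintype V] [LinearOrder V] [Fintype E] [DecidableEq E]
    (he : E → Finset V) (hhe : ∀ e, 2 ≤ (he e).card)
    (hV : 2 ≤ Fintype.card V)
    (w : CliqueEdges he → ℝ) (hw : ∀ f, 0 ≤ w f)
    (γ : ℝ) (hγ : 1 ≤ γ) (hbal : BalancedAssignment he w γ)
    (ε : ℝ) (hε0 : 0 < ε) (hε1 : ε ≤ 1)
    (d : ℕ) (hd : 1 ≤ d)
    (ρ : ℝ)
    (hρ : ρ = 8 * ((d : ℝ) + 6) * γ ^ 2 * Real.log (Fintype.card V) / (0.38 * ε ^ 2))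
    (p : E → ℝ) (hp : ∀ e, p e = min 1 (ρ / kappa he w e)) :
    (1 - 4 / (Fintype.card V : ℝ) ^ d ≤
      ∑ A ∈ Finset.univ.filter (fun A : Finset E =>
          ∀ S : Finset V, S.Nonempty → S ≠ Finset.univ →
            |(∑ e ∈ A, if hCrosses he S e then 1 / p e else 0) -
                ((Finset.univ.filter (fun e => hCrosses he S e)).card : ℝ)|
              ≤ 2 * ε * ((Finset.univ.filter (fun e => hCrosses he S e)).card : ℝ)),
        sampleProb p A) ∧
    (∑ A : Finset E, sampleProb p A * (A.card : ℝ) ≤ ρ * γ * ((Fintype.card V : ℝ) - 1)) := by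
  have hbal1 : ∀ e, (∑ f : CliqueEdges he, if f.1.1 = e then w f else 0) = 1 :=
    fun e => by convert (hbal e).1
  set ep := cep he with hep
  have hne : ∀ f, (ep f).1 ≠ (ep f).2 := fun f => f.2.2.2.ne
  have hown : ∀ f : CliqueEdges he, (ep f).1 ∈ he f.1.1 ∧ (ep f).2 ∈ he f.1.1 :=
    fun f => ⟨f.2.1, f.2.2.1⟩
  have hpair : ∀ e, ∀ a ∈ he e, ∀ b ∈ he e, a ≠ b → ∃ f : CliqueEdges he, f.1.1 = e ∧
      ((ep f = (a, b)) ∨ (ep f = (b, a))) := by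
    intro e a ha b hb hab
    rcases lt_or_gt_of_ne hab with h | h
    · exact ⟨⟨(e, a, b), ha, hb, h⟩, rfl, Or.inl rfl⟩
    · exact ⟨⟨(e, b, a), hb, ha, h⟩, rfl, Or.inr rfl⟩
  have hex : ∀ e, ∃ f : CliqueEdges he, f.1.1 = e := by
    intro e
    obtain ⟨a, ha, b, hb, hab⟩ := Finset.one_lt_card.1 (show 1 < (he e).card from hhe e)
    obtain ⟨f, hf, _⟩ := hpair e a ha b hb hab
    exact ⟨f, hf⟩
  have hfin : ∀ e, {c : ℝ | ∃ f : CliqueEdges he, f.1.1 = e ∧ c = strength (cep he) w f}.Finite := by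
    intro e
    apply (Set.finite_range (fun f : CliqueEdges he => strength (cep he) w f)).subset
    rintro c ⟨f, _, rfl⟩
    exact ⟨f, rfl⟩
  set κ := kappa he w with hκdef
  have hκmem : ∀ e, ∃ f : CliqueEdges he, f.1.1 = e ∧ κ e = strength ep w f := by
    intro e
    obtain ⟨f, hf⟩ := hex e
    exact Set.Nonempty.csInf_mem
      (s := {c : ℝ | ∃ f : CliqueEdges he, f.1.1 = e ∧ c = strength (cep he) w f})
      ⟨_, f, hf, rfl⟩ (hfin e)
  have hκle : ∀ f : CliqueEdges he, κ f.1.1 ≤ strength ep w f := by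
    intro f
    exact csInf_le (hfin f.1.1).bddBelow ⟨f, rfl, rfl⟩
  have hmaxle : ∀ f : CliqueEdges he, 0 < w f → strength ep w f ≤ γ * κ f.1.1 := by
    intro f hf
    refine le_trans ?_ (hbal f.1.1).2
    unfold kappaMax
    apply le_csSup
    · apply Set.Finite.bddAbove
      apply (Set.finite_range (fun f : CliqueEdges he => strength (cep he) w f)).subset
      rintro c ⟨f, _, _, rfl⟩
      exact ⟨f, rfl⟩
    · exact ⟨f, rfl, hf, rfl⟩
  have hκpos : ∀ e, 0 < κ e := by
    intro e
    have h1 := hbal1 e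
    obtain ⟨f, hf, hwf⟩ : ∃ f : CliqueEdges he, f.1.1 = e ∧ 0 < w f := by
      by_contra hcon
      push Not at hcon
      have : (∑ f : CliqueEdges he, if f.1.1 = e then w f else 0) ≤ 0 := by
        apply Finset.sum_nonpos
        intro f _
        split_ifs with h
        · exact hcon f h
        · exact le_rfl
      linarith
    have hs : 0 < strength ep w f := by
      exact hwf.trans_le (weight_le_strength ep w hw f (hne f))
    have := hmaxle f hwf
    rw [hf] at this
    by_contra hcon
    push Not at hcon
    nlinarith
  have hfpos : ∀ f, 0 < strength ep w f := fun f => (hκpos _).trans_le (hκle f)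
  have hn2 : (2 : ℝ) ≤ Fintype.card V := by exact_mod_cast hV
  have hL : 0 < Real.log (Fintype.card V) := Real.log_pos (by linarith)
  have hd0 : (0 : ℝ) ≤ d := Nat.cast_nonneg d
  have hρpos : 0 < ρ := by
    rw [hρ]; positivity
  have hρ4 : 5 * ((d : ℝ) + 6) * Real.log (Fintype.card V) ≤ ρ * ε ^ 2 / 4 := by
    have : ρ * ε ^ 2 / 4 = γ ^ 2 * (2 / 0.38 * (((d : ℝ) + 6) * Real.log (Fintype.card V))) := by
      rw [hρ]; field_simp; ring
    rw [this]
    have h1 : 1 ≤ γ ^ 2 := one_le_pow₀ hγ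
    have h2 : 0 ≤ ((d : ℝ) + 6) * Real.log (Fintype.card V) := by positivity
    set Q := ((d : ℝ) + 6) * Real.log (Fintype.card V) with hQ
    have h3 : 5 * Q ≤ 2 / 0.38 * Q := by
      apply mul_le_mul_of_nonneg_right _ h2
      norm_num
    have h4 : 2 / 0.38 * Q ≤ γ ^ 2 * (2 / 0.38 * Q) := by
      apply le_mul_of_one_le_left _ h1
      positivity
    linarith
  have hZ : ∀ e, (he e).Nonempty := fun e => Finset.card_pos.1 (by have := hhe e; omega)
  have hκ : ∀ e, ∀ z ∈ he e, ∀ k, he e ⊆ comp ep w k z ↔ k ≤ κ e := by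
    intro e z hz k
    constructor
    · intro h
      obtain ⟨f, hfe, hf⟩ := hκmem e
      rw [hf]
      apply le_strength ep w k (comp ep w k z) f (comp_strong ep w hw k z) _ _ (hne f)
      · exact h (hfe ▸ (hown f).1)
      · exact h (hfe ▸ (hown f).2)
    · intro h v hv
      by_cases hvz : z = v
      · rw [← hvz]; exact self_mem_comp ep w k z
      · obtain ⟨f, hfe, hf⟩ := hpair e z hz v hv hvz
        have hk : k ≤ strength ep w f := h.trans (hfe ▸ hκle f)
        have hm := (mem_comp_iff ep w hw k f (hne f)).2 hk
        rcases hf with hf | hf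
        · rw [hf] at hm; exact hm
        · rw [hf] at hm
          have hm' : z ∈ comp ep w k v := hm
          rw [comp_eq ep w hw k v z hm']
          exact self_mem_comp ep w k v
  constructor
  · have main := main_abs ep w hw hne he (fun f => f.1.1) κ hZ hκ hκpos hfpos hown
      hbal1
      (fun e => by obtain ⟨f, _, hf⟩ := hκmem e; exact ⟨f, hf⟩) hV ε ρ hε0 hε1 hρpos d hρ4 p hp
    have h0 : ∀ e, 0 ≤ p e := fun e => by
      rw [hp]; exact le_min zero_le_one (div_nonneg hρpos.le (hκpos e).le)
    have h1 : ∀ e, p e ≤ 1 := fun e => by rw [hp]; exact min_le_left _ _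
    have hone := sampleProb_sum p
    rw [Finset.sum_filter]
    have hkey : ∀ A : Finset E, sampleProb p A ≤ (if ∀ S : Finset V,
        |∑ e, if hCrosses he S e then ((if e ∈ A then 1 / p e else 0) - 1) else 0| ≤
        2 * ε * ∑ e, (if hCrosses he S e then (1 : ℝ) else 0) then 0 else sampleProb p A) +
        (if ∀ S : Finset V, S.Nonempty → S ≠ Finset.univ →
            |(∑ e ∈ A, if hCrosses he S e then 1 / p e else 0) -
                ((Finset.univ.filter (fun e => hCrosses he S e)).card : ℝ)|
              ≤ 2 * ε * ((Finset.univ.filter (fun e => hCrosses he S e)).card : ℝ)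
          then sampleProb p A else 0) := by
      intro A
      have hs := sampleProb_nonneg p h0 h1 A
      by_cases hg : ∀ S : Finset V,
        |∑ e, if hCrosses he S e then ((if e ∈ A then 1 / p e else 0) - 1) else 0| ≤
        2 * ε * ∑ e, (if hCrosses he S e then (1 : ℝ) else 0)
      · rw [if_pos hg, if_pos, zero_add]
        intro S _ _
        have := hg S
        have e1 : (∑ e, (if hCrosses he S e then (1 : ℝ) else 0)) =
            ((Finset.univ.filter (fun e => hCrosses he S e)).card : ℝ) := by
          rw [Finset.sum_boole]
        have e2 : (∑ e, if hCrosses he S e then ((if e ∈ A then 1 / p e else 0) - 1) else 0) =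
            (∑ e ∈ A, if hCrosses he S e then 1 / p e else 0) -
            ∑ e, (if hCrosses he S e then (1 : ℝ) else 0) := by
          have : (∑ e ∈ A, if hCrosses he S e then 1 / p e else 0) =
              ∑ e, if e ∈ A then (if hCrosses he S e then 1 / p e else 0) else 0 := by
            rw [Finset.sum_ite_mem, Finset.univ_inter]
          rw [this, ← Finset.sum_sub_distrib]
          apply Finset.sum_congr rfl
          intro e _
          by_cases a1 : e ∈ A <;> by_cases a2 : hCrosses he S e <;> simp [a1, a2]
        rw [e2, e1] at this
        exact this
      · rw [if_neg hg]
        have : 0 ≤ (if ∀ S : Finset V, S.Nonempty → S ≠ Finset.univ →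
            |(∑ e ∈ A, if hCrosses he S e then 1 / p e else 0) -
                ((Finset.univ.filter (fun e => hCrosses he S e)).card : ℝ)|
              ≤ 2 * ε * ((Finset.univ.filter (fun e => hCrosses he S e)).card : ℝ)
          then sampleProb p A else 0) := by
          split_ifs
          · exact hs
          · exact le_rfl
        linarith
    have hfinal := Finset.sum_le_sum (fun A (_ : A ∈ (Finset.univ : Finset (Finset E))) => hkey A)
    rw [Finset.sum_add_distrib, hone] at hfinal
    linarith
  · rw [sampleProb_card]
    have hBK := sum_div_strength ep w hw hne hfpos _ Finset.univ rfl
      (Finset.card_pos.1 (by rw [Finset.card_univ]; omega))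
    simp only [Finset.mem_univ, and_self, if_true, Finset.card_univ] at hBK
    have h1 : ∀ e, p e ≤ ρ * ∑ f : CliqueEdges he,
        if f.1.1 = e then γ * (w f / strength ep w f) else 0 := by
      intro e
      rw [hp]
      refine (min_le_right _ _).trans ?_
      rw [div_eq_mul_inv]
      apply mul_le_mul_of_nonneg_left _ hρpos.le
      calc (κ e)⁻¹ = (∑ f : CliqueEdges he, if f.1.1 = e then w f else 0) * (κ e)⁻¹ := by
            rw [hbal1 e, one_mul]
        _ ≤ _ := by
            rw [Finset.sum_mul]
            apply Finset.sum_le_sum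
            intro f _
            by_cases hfe : f.1.1 = e
            · rw [if_pos hfe, if_pos hfe]
              rcases (hw f).lt_or_eq with h | h
              · have hm := hmaxle f h
                rw [hfe] at hm
                rw [← div_eq_mul_inv, ← mul_div_assoc, div_le_div_iff₀ (hκpos e) (hfpos f)]
                have := mul_le_mul_of_nonneg_left hm (hw f)
                linarith
              · rw [← h]; simp
            · rw [if_neg hfe, if_neg hfe]; simp
    refine (Finset.sum_le_sum (fun e _ => h1 e)).trans ?_
    rw [← Finset.mul_sum, Finset.sum_comm, mul_assoc]
    apply mul_le_mul_of_nonneg_left _ hρpos.le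
    have : ∀ f : CliqueEdges he, (∑ e, if f.1.1 = e then γ * (w f / strength ep w f) else 0) =
        γ * (w f / strength ep w f) := by
      intro f
      rw [Finset.sum_ite_eq, if_pos (Finset.mem_univ _)]
    rw [Finset.sum_congr rfl (fun f _ => this f), ← Finset.mul_sum]
    exact mul_le_mul_of_nonneg_left hBK (by linarith)
end
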